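/- arXiv:1307.2842 — 9 statements merged into one kernel-verified Lean document; each statement's English description precedes it below -/
import Mathlib

section
/- For every integer n ≥ 0 and every real x, the iterated Volterra coefficient satisfies |m_{L1}^n(x)| ≤ (1/(2n)!) · (∫_x^{+∞} a(s) ds)^{2n}. -/
open MeasureTheory Set Filter

noncomputable def mL1 (q : ℝ → ℂ) (lam : ℝ) : ℕ → ℝ → ℂ
  | 0, _ => 1
  | n + 1, x =>
      ∫ y in Ioi x, (∫ t in Ioi y,
        Complex.exp (2 * Complex.I * (lam : ℂ) * ((t : ℂ) - (y : ℂ))) * q y *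
          (starRingEnd ℂ) (q t) * mL1 q lam n t)

theorem tail_aux (a : ℝ → ℝ)
    (ha_cont : Continuous a) (ha_nonneg : ∀ x, 0 ≤ a x) (ha_int : Integrable a) (k : ℕ) (x : ℝ) :
    IntegrableOn (fun t => a t * (1 / (k.factorial : ℝ) * (∫ s in Ioi t, a s) ^ k)) (Ioi x) ∧
    ∫ t in Ioi x, a t * (1 / (k.factorial : ℝ) * (∫ s in Ioi t, a s) ^ k) =
      1 / ((k + 1).factorial : ℝ) * (∫ s in Ioi x, a s) ^ (k + 1) := by
  have hA : (fun t => ∫ s in Ioi t, a s) = fun t => (∫ s in Ioi 0, a s) - ∫ s in (0 : ℝ)..t, a s := by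
    funext t
    rw [← intervalIntegral.integral_Ioi_sub_Ioi' ha_int.integrableOn ha_int.integrableOn]
    ring
  have hd : ∀ t, HasDerivAt (fun t => ∫ s in Ioi t, a s) (-a t) t := by
    intro t
    rw [hA]
    exact (ha_cont.integral_hasStrictDerivAt 0 t).hasDerivAt.const_sub _
  have hlim : Tendsto (fun t => ∫ s in Ioi t, a s) atTop (nhds 0) := by
    rw [hA]
    have := (intervalIntegral_tendsto_integral_Ioi (f := a) (μ := volume) 0
      ha_int.integrableOn tendsto_id).const_sub (∫ s in Ioi 0, a s)
    simpa using this
  have hF : ∀ t, HasDerivAt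
      (fun t => -(1 / ((k + 1).factorial : ℝ) * (∫ s in Ioi t, a s) ^ (k + 1)))
      (a t * (1 / (k.factorial : ℝ) * (∫ s in Ioi t, a s) ^ k)) t := by
    intro t
    have h := (((hd t).pow (k + 1)).const_mul (1 / ((k + 1).factorial : ℝ))).neg
    refine h.congr_deriv ?_
    have : (k.factorial : ℝ) ≠ 0 := by positivity
    rw [Nat.factorial_succ]
    push_cast
    have : (k : ℝ) + 1 ≠ 0 := by positivity
    field_simp
  have hFl : Tendsto (fun t => -(1 / ((k + 1).factorial : ℝ) * (∫ s in Ioi t, a s) ^ (k + 1)))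
      atTop (nhds 0) := by
    simpa using ((hlim.pow (k + 1)).const_mul (1 / ((k + 1).factorial : ℝ))).neg
  have hi : IntegrableOn (fun t => a t * (1 / (k.factorial : ℝ) * (∫ s in Ioi t, a s) ^ k))
      (Ioi x) := by
    refine integrableOn_Ioi_deriv_of_nonneg' (fun t _ => hF t) (fun t _ => ?_) hFl
    have : 0 ≤ ∫ s in Ioi t, a s := integral_nonneg ha_nonneg
    have := ha_nonneg t
    positivity
  refine ⟨hi, ?_⟩
  rw [integral_Ioi_of_hasDerivAt_of_tendsto' (fun t _ => hF t) hi hFl]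
  ring

theorem stmt0
    (a : ℝ → ℝ) (q : ℝ → ℂ) (lam : ℝ)
    (ha_cont : Continuous a) (ha_nonneg : ∀ x, 0 ≤ a x) (ha_int : Integrable a)
    (hq_cont : Continuous q) (hq_abs : ∀ x, ‖q x‖ = a x) :
    ∀ (n : ℕ) (x : ℝ),
      ‖mL1 q lam n x‖ ≤ (1 / ((2 * n).factorial : ℝ)) * (∫ s in Ioi x, a s) ^ (2 * n) := by
  intro n
  induction n with
  | zero => intro x; simp [mL1]
  | succ n ih =>
    intro x
    rw [mL1]
    have h2 := tail_aux a ha_cont ha_nonneg ha_int (2 * n + 1) x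
    have e : 2 * (n + 1) = 2 * n + 1 + 1 := by ring
    rw [e, ← h2.2]
    refine norm_integral_le_of_norm_le h2.1 (Eventually.of_forall fun y => ?_)
    have h1 := tail_aux a ha_cont ha_nonneg ha_int (2 * n) y
    rw [← h1.2, ← integral_const_mul]
    refine norm_integral_le_of_norm_le (h1.1.const_mul _) (Eventually.of_forall fun t => ?_)
    have he : ‖Complex.exp (2 * Complex.I * (lam : ℂ) * ((t : ℂ) - (y : ℂ)))‖ = 1 := by
      rw [Complex.norm_exp]
      simp
    rw [norm_mul, norm_mul, norm_mul, he, RCLike.norm_conj, hq_abs, hq_abs, one_mul, mul_assoc]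
    exact mul_le_mul_of_nonneg_left
      (mul_le_mul_of_nonneg_left (ih t) (ha_nonneg t)) (ha_nonneg y)
end

section
/- The scattering coefficients a_{Lj}(λ,z) are well defined for every z ∈ ℂ, with everywhere-convergent expansions a_{L1}(λ,z) = 1 − i Σ_{n≥0} (∫_ℝ q(x) m_{L3}^n(x) dx) z^{2n+2}, a_{L2}(λ,z) = −i Σ_{n≥0} (∫_ℝ e^{−2iλx} q(x) m_{L4}^n(x) dx) z^{2n+1}, a_{L3}(λ,z) = i Σ_{n≥0} (∫_ℝ e^{2iλx} conj(q(x)) m_{L1}^n(x) dx) z^{2n+1}, a_{L4}(λ,z) = 1 + i Σ_{n≥0} (∫_ℝ conj(q(x)) m_{L2}^n(x) dx) z^{2n+2}, and they satisfy the bounds |a_{L1}(λ,z)| ≤ cosh(A|z|), |a_{L4}(λ,z)| ≤ cosh(A|z|), |a_{L2}(λ,z)| ≤ sinh(A|z|), |a_{L3}(λ,z)| ≤ sinh(A|z|) for all z ∈ ℂ. -/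
open MeasureTheory Set Filter

noncomputable def mL2 (q : ℝ → ℂ) (lam : ℝ) : ℕ → ℝ → ℂ
  | 0, x =>
      -Complex.I * (∫ y in Ioi x,
        Complex.exp (-(2 * Complex.I * (lam : ℂ) * ((y : ℂ) - (x : ℂ)))) * q y)
  | n + 1, x =>
      ∫ y in Ioi x, (∫ t in Ioi y,
        Complex.exp (-(2 * Complex.I * (lam : ℂ) * ((y : ℂ) - (x : ℂ)))) * q y *
          (starRingEnd ℂ) (q t) * mL2 q lam n t)

noncomputable def mL3 (q : ℝ → ℂ) (lam : ℝ) : ℕ → ℝ → ℂ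
  | 0, x =>
      Complex.I * (∫ y in Ioi x,
        Complex.exp (2 * Complex.I * (lam : ℂ) * ((y : ℂ) - (x : ℂ))) * (starRingEnd ℂ) (q y))
  | n + 1, x =>
      ∫ y in Ioi x, (∫ t in Ioi y,
        Complex.exp (2 * Complex.I * (lam : ℂ) * ((y : ℂ) - (x : ℂ))) * (starRingEnd ℂ) (q y) *
          q t * mL3 q lam n t)

noncomputable def mL4 (q : ℝ → ℂ) (lam : ℝ) : ℕ → ℝ → ℂ
  | 0, _ => 1
  | n + 1, x =>
      ∫ y in Ioi x, (∫ t in Ioi y,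
        Complex.exp (-(2 * Complex.I * (lam : ℂ) * ((t : ℂ) - (y : ℂ)))) * (starRingEnd ℂ) (q y) *
          q t * mL4 q lam n t)

noncomputable def ML1 (q : ℝ → ℂ) (lam : ℝ) (x : ℝ) (z : ℂ) : ℂ :=
  ∑' n : ℕ, mL1 q lam n x * z ^ (2 * n)

noncomputable def ML2 (q : ℝ → ℂ) (lam : ℝ) (x : ℝ) (z : ℂ) : ℂ :=
  ∑' n : ℕ, mL2 q lam n x * z ^ (2 * n + 1)

noncomputable def ML3 (q : ℝ → ℂ) (lam : ℝ) (x : ℝ) (z : ℂ) : ℂ :=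
  ∑' n : ℕ, mL3 q lam n x * z ^ (2 * n + 1)

noncomputable def ML4 (q : ℝ → ℂ) (lam : ℝ) (x : ℝ) (z : ℂ) : ℂ :=
  ∑' n : ℕ, mL4 q lam n x * z ^ (2 * n)

noncomputable def aL1 (q : ℝ → ℂ) (lam : ℝ) (z : ℂ) : ℂ :=
  1 - Complex.I * z * (∫ x : ℝ, q x * ML3 q lam x z)

noncomputable def aL2 (q : ℝ → ℂ) (lam : ℝ) (z : ℂ) : ℂ :=
  -Complex.I * z * (∫ x : ℝ, Complex.exp (-(2 * Complex.I * (lam : ℂ) * (x : ℂ))) * q x * ML4 q lam x z)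

noncomputable def aL3 (q : ℝ → ℂ) (lam : ℝ) (z : ℂ) : ℂ :=
  Complex.I * z * (∫ x : ℝ, Complex.exp (2 * Complex.I * (lam : ℂ) * (x : ℂ)) * (starRingEnd ℂ) (q x) * ML1 q lam x z)

noncomputable def aL4 (q : ℝ → ℂ) (lam : ℝ) (z : ℂ) : ℂ :=
  1 + Complex.I * z * (∫ x : ℝ, (starRingEnd ℂ) (q x) * ML2 q lam x z)

open Topology

noncomputable def TT (a : ℝ → ℝ) (x : ℝ) : ℝ := ∫ y in Ioi x, a y

lemma hasDeriv_tail {E : Type*} [NormedAddCommGroup E] [NormedSpace ℝ E] [CompleteSpace E]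
    {f : ℝ → E} (hf : Continuous f) (hi : Integrable f) (x : ℝ) :
    HasDerivAt (fun x => ∫ y in Ioi x, f y) (-(f x)) x := by
  have h : (fun x => ∫ y in Ioi x, f y) = fun x => (∫ y in Ioi 0, f y) - ∫ y in (0:ℝ)..x, f y := by
    funext x
    rw [← intervalIntegral.integral_Ioi_sub_Ioi' hi.integrableOn hi.integrableOn]
    abel
  rw [h]
  exact (hf.integral_hasStrictDerivAt 0 x).hasDerivAt.const_sub _

lemma TT_nonneg {a : ℝ → ℝ} (h0 : ∀ x, 0 ≤ a x) (x : ℝ) : 0 ≤ TT a x :=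
  integral_nonneg h0

lemma TT_le {a : ℝ → ℝ} (h0 : ∀ x, 0 ≤ a x) (hi : Integrable a) (x : ℝ) :
    TT a x ≤ ∫ y, a y :=
  setIntegral_le_integral hi (Eventually.of_forall h0)

lemma TT_cont {a : ℝ → ℝ} (hc : Continuous a) (hi : Integrable a) : Continuous (TT a) :=
  continuous_iff_continuousAt.2 fun x => (hasDeriv_tail hc hi x).continuousAt

lemma aTT_int {a : ℝ → ℝ} (hc : Continuous a) (h0 : ∀ x, 0 ≤ a x) (hi : Integrable a) (k : ℕ) :
    Integrable fun y => a y * (TT a y ^ k / (k.factorial : ℝ)) := by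
  refine (hi.mul_const ((∫ y, a y) ^ k / (k.factorial : ℝ))).mono'
    (hc.mul (((TT_cont hc hi).pow k).div_const _)).aestronglyMeasurable
    (Eventually.of_forall fun y => ?_)
  have h1 := TT_nonneg h0 y
  have h2 := TT_le h0 hi y
  have h3 := h0 y
  rw [Real.norm_of_nonneg (by positivity)]
  gcongr

lemma aTT_eq {a : ℝ → ℝ} (hc : Continuous a) (h0 : ∀ x, 0 ≤ a x) (hi : Integrable a) (k : ℕ)
    (x : ℝ) :
    ∫ y in Ioi x, a y * (TT a y ^ k / (k.factorial : ℝ)) =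
      TT a x ^ (k+1) / ((k+1).factorial : ℝ) := by
  have hd : ∀ y ∈ Ici x, HasDerivAt (fun y => -(TT a y ^ (k+1) / ((k+1).factorial : ℝ)))
      (a y * (TT a y ^ k / (k.factorial : ℝ))) y := by
    intro y _
    have := (((hasDeriv_tail hc hi y).pow (k+1)).div_const ((k+1).factorial : ℝ)).neg
    refine this.congr_deriv ?_
    rw [Nat.factorial_succ]
    have : (k.factorial : ℝ) ≠ 0 := by positivity
    have : (k : ℝ) + 1 ≠ 0 := by positivity
    simp only [TT]
    push_cast
    field_simp
  have ht : Tendsto (fun y => -(TT a y ^ (k+1) / ((k+1).factorial : ℝ))) atTop (𝓝 0) := by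
    have h : Tendsto (TT a) atTop (𝓝 0) := tendsto_integral_Ioi_zero tendsto_id
    have := ((h.pow (k+1)).div_const ((k+1).factorial : ℝ)).neg
    simpa using this
  rw [integral_Ioi_of_hasDerivAt_of_tendsto' hd (aTT_int hc h0 hi k).integrableOn ht]
  ring

def PP (a : ℝ → ℝ) (k : ℕ) (f : ℝ → ℂ) : Prop :=
  Continuous f ∧ ∀ x, ‖f x‖ ≤ TT a x ^ k / (k.factorial : ℝ)

section
variable {a : ℝ → ℝ} (hc : Continuous a) (h0 : ∀ x, 0 ≤ a x) (hi : Integrable a)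

lemma PP_norm {k : ℕ} {f u : ℝ → ℂ} (hf : PP a k f) (h0 : ∀ x, 0 ≤ a x) (hu' : ∀ x, ‖u x‖ = a x)
    (y : ℝ) : ‖u y * f y‖ ≤ a y * (TT a y ^ k / (k.factorial : ℝ)) := by
  rw [norm_mul, hu' y]
  exact mul_le_mul_of_nonneg_left (hf.2 y) (h0 y)

lemma PP_int (hc : Continuous a) (h0 : ∀ x, 0 ≤ a x) (hi : Integrable a)
    {k : ℕ} {f u : ℝ → ℂ} (hf : PP a k f) (hu : Continuous u) (hu' : ∀ x, ‖u x‖ = a x) :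
    Integrable fun y => u y * f y :=
  (aTT_int hc h0 hi k).mono' (hu.mul hf.1).aestronglyMeasurable
    (Eventually.of_forall (PP_norm hf h0 hu'))

lemma PP_step (hc : Continuous a) (h0 : ∀ x, 0 ≤ a x) (hi : Integrable a)
    {k : ℕ} {f u : ℝ → ℂ} (hf : PP a k f) (hu : Continuous u) (hu' : ∀ x, ‖u x‖ = a x) :
    PP a (k+1) (fun x => ∫ y in Ioi x, u y * f y) := by
  refine ⟨continuous_iff_continuousAt.2 fun x =>
    (hasDeriv_tail (hu.mul hf.1) (PP_int hc h0 hi hf hu hu') x).continuousAt, fun x => ?_⟩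
  rw [← aTT_eq hc h0 hi k x]
  exact norm_integral_le_of_norm_le (aTT_int hc h0 hi k).integrableOn
    (Eventually.of_forall (PP_norm hf h0 hu'))

lemma PP_unit {k : ℕ} {f u : ℝ → ℂ} (hf : PP a k f) (hu : Continuous u) (hu' : ∀ x, ‖u x‖ = 1) :
    PP a k (fun x => u x * f x) :=
  ⟨hu.mul hf.1, fun x => by rw [norm_mul, hu' x, one_mul]; exact hf.2 x⟩

lemma PP_one : PP a 0 (fun _ => 1) := ⟨continuous_const, fun x => by simp⟩

lemma PP_total (hc : Continuous a) (h0 : ∀ x, 0 ≤ a x) (hi : Integrable a)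
    {k : ℕ} {f u : ℝ → ℂ} (hf : PP a k f) (hu : Continuous u) (hu' : ∀ x, ‖u x‖ = a x) :
    ∫ y, ‖u y * f y‖ ≤ (∫ y, a y) ^ (k+1) / ((k+1).factorial : ℝ) := by
  have hI := PP_int hc h0 hi hf hu hu'
  have ht := (aecover_Ioi (μ := volume) (tendsto_id : Tendsto id (atBot : Filter ℝ) atBot)).integral_tendsto_of_countably_generated hI.norm
  refine le_of_tendsto' ht fun x => ?_
  calc ∫ y in Ioi x, ‖u y * f y‖ ≤ ∫ y in Ioi x, a y * (TT a y ^ k / (k.factorial : ℝ)) :=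
        integral_mono hI.norm.integrableOn (aTT_int hc h0 hi k).integrableOn (PP_norm hf h0 hu')
    _ = TT a x ^ (k+1) / ((k+1).factorial : ℝ) := aTT_eq hc h0 hi k x
    _ ≤ _ := by
      have h1 := TT_nonneg h0 x
      have h2 := TT_le h0 hi x
      gcongr

lemma PP_main (hc : Continuous a) (h0 : ∀ x, 0 ≤ a x) (hi : Integrable a)
    {r : ℕ} {m : ℕ → ℝ → ℂ} {u : ℝ → ℂ} (hm : ∀ n, PP a (2*n+r) (m n))
    (hu : Continuous u) (hu' : ∀ x, ‖u x‖ = a x) (z : ℂ) :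
    (Integrable fun x => u x * ∑' n, m n x * z ^ (2*n+r)) ∧
    (Summable fun n : ℕ => (∫ x, u x * m n x) * z ^ (2*n+r+1)) ∧
    (z * ∫ x, u x * ∑' n, m n x * z ^ (2*n+r)) = ∑' n, (∫ x, u x * m n x) * z ^ (2*n+r+1) ∧
    (∀ n, ‖(∫ x, u x * m n x) * z ^ (2*n+r+1)‖ ≤
      ((∫ x, a x) * ‖z‖) ^ (2*n+r+1) / ((2*n+r+1).factorial : ℝ)) := by
  set A := ∫ x, a x with hA
  have hA0 : 0 ≤ A := integral_nonneg h0
  have hinj : ∀ s, Function.Injective fun n : ℕ => 2*n+s := fun s i j h => by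
    simp only at h; omega
  have hS : ∀ s, Summable fun n : ℕ => (A * ‖z‖) ^ (2*n+s) / ((2*n+s).factorial : ℝ) := fun s =>
    (Real.summable_pow_div_factorial (A * ‖z‖)).comp_injective (hinj s)
  have hb : ∀ n, ‖(∫ x, u x * m n x) * z ^ (2*n+r+1)‖ ≤
      (A * ‖z‖) ^ (2*n+r+1) / ((2*n+r+1).factorial : ℝ) := by
    intro n
    rw [norm_mul, norm_pow, mul_pow, mul_div_right_comm]
    gcongr
    exact (norm_integral_le_integral_norm _).trans (PP_total hc h0 hi (hm n) hu hu')
  have hmb : ∀ n x, ‖m n x * z ^ (2*n+r)‖ ≤ (A * ‖z‖) ^ (2*n+r) / ((2*n+r).factorial : ℝ) := by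
    intro n x
    rw [norm_mul, norm_pow, mul_pow, mul_div_right_comm]
    gcongr
    refine ((hm n).2 x).trans ?_
    have h1 := TT_nonneg h0 x
    have h2 := TT_le h0 hi x
    gcongr
  have hcont : Continuous fun x => ∑' n, m n x * z ^ (2*n+r) :=
    continuous_tsum (fun n => (hm n).1.mul continuous_const) (hS r) hmb
  refine ⟨?_, (hS (r+1)).of_norm_bounded hb, ?_, hb⟩
  · refine (hi.mul_const (∑' n, (A * ‖z‖) ^ (2*n+r) / ((2*n+r).factorial : ℝ))).mono'
      (hu.mul hcont).aestronglyMeasurable (Eventually.of_forall fun x => ?_)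
    rw [norm_mul, hu' x]
    exact mul_le_mul_of_nonneg_left (tsum_of_norm_bounded (hS r).hasSum fun n => hmb n x) (h0 x)
  · have hint : ∀ n, Integrable fun x => (u x * m n x) * z ^ (2*n+r+1) := fun n =>
      (PP_int hc h0 hi (hm n) hu hu').mul_const _
    have hsum : Summable fun n => ∫ x, ‖(u x * m n x) * z ^ (2*n+r+1)‖ := by
      refine (hS (r+1)).of_nonneg_of_le (fun n => integral_nonneg fun x => norm_nonneg _) fun n => ?_
      simp_rw [norm_mul _ (z ^ _)]
      rw [integral_mul_const, norm_pow, mul_pow, mul_div_right_comm]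
      have := PP_total hc h0 hi (hm n) hu hu'
      have h3 : 2*n+(r+1) = 2*n+r+1 := by ring
      rw [h3]
      gcongr
    have := (hasSum_integral_of_summable_integral_norm hint hsum).tsum_eq
    simp_rw [integral_mul_const] at this
    rw [this, ← integral_const_mul]
    congr 1
    funext x
    rw [← mul_assoc, ← tsum_mul_left]
    congr 1
    funext n
    ring

lemma bound_sinh {c : ℕ → ℂ} {A : ℝ} (h : ∀ n, ‖c n‖ ≤ A ^ (2*n+0+1) / ((2*n+0+1).factorial : ℝ)) :
    ‖∑' n, c n‖ ≤ Real.sinh A :=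
  tsum_of_norm_bounded (Real.hasSum_sinh A) h

lemma bound_cosh {c : ℕ → ℂ} {A : ℝ} (h : ∀ n, ‖c n‖ ≤ A ^ (2*n+1+1) / ((2*n+1+1).factorial : ℝ)) :
    1 + ‖∑' n, c n‖ ≤ Real.cosh A := by
  have h1 := (hasSum_nat_add_iff' 1).2 (Real.hasSum_cosh A)
  have h2 := tsum_of_norm_bounded h1 h
  simp at h2
  linarith

end

lemma norm_e (lam x : ℝ) : ‖Complex.exp (2 * Complex.I * (lam : ℂ) * (x : ℂ))‖ = 1 := by
  rw [show 2 * Complex.I * (lam : ℂ) * (x : ℂ) = ((2*lam*x : ℝ) : ℂ) * Complex.I by push_cast; ring]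
  exact Complex.norm_exp_ofReal_mul_I _

lemma norm_e' (lam x : ℝ) : ‖Complex.exp (-(2 * Complex.I * (lam : ℂ) * (x : ℂ)))‖ = 1 := by
  rw [Complex.exp_neg, norm_inv, norm_e, inv_one]

lemma split1 (lam s t : ℝ) : Complex.exp (2 * Complex.I * (lam : ℂ) * ((t : ℂ) - (s : ℂ))) =
    Complex.exp (-(2 * Complex.I * (lam : ℂ) * (s : ℂ))) *
    Complex.exp (2 * Complex.I * (lam : ℂ) * (t : ℂ)) := by
  rw [← Complex.exp_add]; congr 1; ring

lemma split2 (lam s t : ℝ) : Complex.exp (-(2 * Complex.I * (lam : ℂ) * ((t : ℂ) - (s : ℂ)))) =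
    Complex.exp (2 * Complex.I * (lam : ℂ) * (s : ℂ)) *
    Complex.exp (-(2 * Complex.I * (lam : ℂ) * (t : ℂ))) := by
  rw [← Complex.exp_add]; congr 1; ring

lemma cont_e (lam : ℝ) : Continuous fun x : ℝ => Complex.exp (2 * Complex.I * (lam : ℂ) * (x : ℂ)) := by
  fun_prop

lemma cont_e' (lam : ℝ) :
    Continuous fun x : ℝ => Complex.exp (-(2 * Complex.I * (lam : ℂ) * (x : ℂ))) := by
  fun_prop

section
variable {a : ℝ → ℝ} {q : ℝ → ℂ} (lam : ℝ)

lemma PP1 (hc : Continuous a) (h0 : ∀ x, 0 ≤ a x) (hi : Integrable a)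
    (hq : Continuous q) (hq' : ∀ x, ‖q x‖ = a x) (n : ℕ) : PP a (2*n+0) (mL1 q lam n) := by
  induction n with
  | zero => exact PP_one
  | succ n ih =>
    have h1 := PP_step hc h0 hi ih
      (u := fun t => Complex.exp (2 * Complex.I * (lam : ℂ) * (t : ℂ)) * (starRingEnd ℂ) (q t))
      ((cont_e lam).mul (Complex.continuous_conj.comp hq))
      (fun x => by rw [norm_mul, norm_e, RCLike.norm_conj, hq', one_mul])
    have h2 := PP_step hc h0 hi h1
      (u := fun t => Complex.exp (-(2 * Complex.I * (lam : ℂ) * (t : ℂ))) * q t)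
      ((cont_e' lam).mul hq)
      (fun x => by rw [norm_mul, norm_e', hq', one_mul])
    change PP a (2*n+0+1+1) _
    convert h2 using 1
    funext x
    rw [mL1]
    congr 1
    funext y
    rw [← integral_const_mul]
    congr 1
    funext t
    rw [split1]
    ring

lemma PP4 (hc : Continuous a) (h0 : ∀ x, 0 ≤ a x) (hi : Integrable a)
    (hq : Continuous q) (hq' : ∀ x, ‖q x‖ = a x) (n : ℕ) : PP a (2*n+0) (mL4 q lam n) := by
  induction n with
  | zero => exact PP_one
  | succ n ih =>
    have h1 := PP_step hc h0 hi ih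
      (u := fun t => Complex.exp (-(2 * Complex.I * (lam : ℂ) * (t : ℂ))) * q t)
      ((cont_e' lam).mul hq)
      (fun x => by rw [norm_mul, norm_e', hq', one_mul])
    have h2 := PP_step hc h0 hi h1
      (u := fun t => Complex.exp (2 * Complex.I * (lam : ℂ) * (t : ℂ)) * (starRingEnd ℂ) (q t))
      ((cont_e lam).mul (Complex.continuous_conj.comp hq))
      (fun x => by rw [norm_mul, norm_e, RCLike.norm_conj, hq', one_mul])
    change PP a (2*n+0+1+1) _
    convert h2 using 1
    funext x
    rw [mL4]
    congr 1
    funext y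
    rw [← integral_const_mul]
    congr 1
    funext t
    rw [split2]
    ring

lemma PP2 (hc : Continuous a) (h0 : ∀ x, 0 ≤ a x) (hi : Integrable a)
    (hq : Continuous q) (hq' : ∀ x, ‖q x‖ = a x) (n : ℕ) : PP a (2*n+1) (mL2 q lam n) := by
  induction n with
  | zero =>
    have h1 := PP_step hc h0 hi PP_one
      (u := fun t => Complex.exp (-(2 * Complex.I * (lam : ℂ) * (t : ℂ))) * q t)
      ((cont_e' lam).mul hq)
      (fun x => by rw [norm_mul, norm_e', hq', one_mul])
    have h2 := PP_unit h1
      (u := fun t => -Complex.I * Complex.exp (2 * Complex.I * (lam : ℂ) * (t : ℂ)))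
      (continuous_const.mul (cont_e lam)) (fun x => by rw [norm_mul, norm_e]; simp)
    convert h2 using 1
    funext x
    rw [mL2, ← integral_const_mul, ← integral_const_mul]
    congr 1
    funext y
    rw [split2]
    ring
  | succ n ih =>
    have h1 := PP_step hc h0 hi ih (u := fun t => (starRingEnd ℂ) (q t))
      (Complex.continuous_conj.comp hq) (fun x => by rw [RCLike.norm_conj, hq'])
    have h2 := PP_step hc h0 hi h1
      (u := fun t => Complex.exp (-(2 * Complex.I * (lam : ℂ) * (t : ℂ))) * q t)
      ((cont_e' lam).mul hq)
      (fun x => by rw [norm_mul, norm_e', hq', one_mul])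
    have h3 := PP_unit h2 (cont_e lam) (norm_e lam)
    change PP a (2*n+1+1+1) _
    convert h3 using 1
    funext x
    rw [mL2, ← integral_const_mul]
    congr 1
    funext y
    rw [← integral_const_mul, ← integral_const_mul]
    congr 1
    funext t
    rw [split2]
    ring

lemma PP3 (hc : Continuous a) (h0 : ∀ x, 0 ≤ a x) (hi : Integrable a)
    (hq : Continuous q) (hq' : ∀ x, ‖q x‖ = a x) (n : ℕ) : PP a (2*n+1) (mL3 q lam n) := by
  induction n with
  | zero =>
    have h1 := PP_step hc h0 hi PP_one
      (u := fun t => Complex.exp (2 * Complex.I * (lam : ℂ) * (t : ℂ)) * (starRingEnd ℂ) (q t))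
      ((cont_e lam).mul (Complex.continuous_conj.comp hq))
      (fun x => by rw [norm_mul, norm_e, RCLike.norm_conj, hq', one_mul])
    have h2 := PP_unit h1
      (u := fun t => Complex.I * Complex.exp (-(2 * Complex.I * (lam : ℂ) * (t : ℂ))))
      (continuous_const.mul (cont_e' lam)) (fun x => by rw [norm_mul, norm_e']; simp)
    convert h2 using 1
    funext x
    rw [mL3, ← integral_const_mul, ← integral_const_mul]
    congr 1
    funext y
    rw [split1]
    ring
  | succ n ih =>
    have h1 := PP_step hc h0 hi ih (u := q) hq hq'
    have h2 := PP_step hc h0 hi h1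
      (u := fun t => Complex.exp (2 * Complex.I * (lam : ℂ) * (t : ℂ)) * (starRingEnd ℂ) (q t))
      ((cont_e lam).mul (Complex.continuous_conj.comp hq))
      (fun x => by rw [norm_mul, norm_e, RCLike.norm_conj, hq', one_mul])
    have h3 := PP_unit h2 (cont_e' lam) (norm_e' lam)
    change PP a (2*n+1+1+1) _
    convert h3 using 1
    funext x
    rw [mL3, ← integral_const_mul]
    congr 1
    funext y
    rw [← integral_const_mul, ← integral_const_mul]
    congr 1
    funext t
    rw [split1]
    ring

end

theorem stmt3
    (a : ℝ → ℝ) (q : ℝ → ℂ) (lam : ℝ)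
    (ha_cont : Continuous a) (ha_nonneg : ∀ x, 0 ≤ a x) (ha_int : Integrable a)
    (hq_cont : Continuous q) (hq_abs : ∀ x, ‖q x‖ = a x) :
    ∀ z : ℂ,
      (Integrable fun x : ℝ => q x * ML3 q lam x z) ∧
      (Integrable fun x : ℝ =>
        Complex.exp (-(2 * Complex.I * (lam : ℂ) * (x : ℂ))) * q x * ML4 q lam x z) ∧
      (Integrable fun x : ℝ =>
        Complex.exp (2 * Complex.I * (lam : ℂ) * (x : ℂ)) * (starRingEnd ℂ) (q x) * ML1 q lam x z) ∧
      (Integrable fun x : ℝ => (starRingEnd ℂ) (q x) * ML2 q lam x z) ∧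
      (Summable fun n : ℕ => (∫ x : ℝ, q x * mL3 q lam n x) * z ^ (2 * n + 2)) ∧
      (aL1 q lam z = 1 - Complex.I * ∑' n : ℕ, (∫ x : ℝ, q x * mL3 q lam n x) * z ^ (2 * n + 2)) ∧
      (Summable fun n : ℕ =>
        (∫ x : ℝ, Complex.exp (-(2 * Complex.I * (lam : ℂ) * (x : ℂ))) * q x * mL4 q lam n x) *
          z ^ (2 * n + 1)) ∧
      (aL2 q lam z = -Complex.I * ∑' n : ℕ,
        (∫ x : ℝ, Complex.exp (-(2 * Complex.I * (lam : ℂ) * (x : ℂ))) * q x * mL4 q lam n x) *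
          z ^ (2 * n + 1)) ∧
      (Summable fun n : ℕ =>
        (∫ x : ℝ, Complex.exp (2 * Complex.I * (lam : ℂ) * (x : ℂ)) * (starRingEnd ℂ) (q x) *
          mL1 q lam n x) * z ^ (2 * n + 1)) ∧
      (aL3 q lam z = Complex.I * ∑' n : ℕ,
        (∫ x : ℝ, Complex.exp (2 * Complex.I * (lam : ℂ) * (x : ℂ)) * (starRingEnd ℂ) (q x) *
          mL1 q lam n x) * z ^ (2 * n + 1)) ∧
      (Summable fun n : ℕ => (∫ x : ℝ, (starRingEnd ℂ) (q x) * mL2 q lam n x) * z ^ (2 * n + 2)) ∧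
      (aL4 q lam z = 1 + Complex.I * ∑' n : ℕ,
        (∫ x : ℝ, (starRingEnd ℂ) (q x) * mL2 q lam n x) * z ^ (2 * n + 2)) ∧
      ‖aL1 q lam z‖ ≤ Real.cosh ((∫ x : ℝ, a x) * ‖z‖) ∧
      ‖aL4 q lam z‖ ≤ Real.cosh ((∫ x : ℝ, a x) * ‖z‖) ∧
      ‖aL2 q lam z‖ ≤ Real.sinh ((∫ x : ℝ, a x) * ‖z‖) ∧
      ‖aL3 q lam z‖ ≤ Real.sinh ((∫ x : ℝ, a x) * ‖z‖) := by
  intro z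
  obtain ⟨i1, s1, e1, b1⟩ := PP_main ha_cont ha_nonneg ha_int
    (PP3 lam ha_cont ha_nonneg ha_int hq_cont hq_abs) hq_cont hq_abs z
  obtain ⟨i2, s2, e2, b2⟩ := PP_main ha_cont ha_nonneg ha_int
    (PP4 lam ha_cont ha_nonneg ha_int hq_cont hq_abs)
    (u := fun t => Complex.exp (-(2 * Complex.I * (lam : ℂ) * (t : ℂ))) * q t)
    ((cont_e' lam).mul hq_cont)
    (fun x => by rw [norm_mul, norm_e', hq_abs, one_mul]) z
  obtain ⟨i3, s3, e3, b3⟩ := PP_main ha_cont ha_nonneg ha_int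
    (PP1 lam ha_cont ha_nonneg ha_int hq_cont hq_abs)
    (u := fun t => Complex.exp (2 * Complex.I * (lam : ℂ) * (t : ℂ)) * (starRingEnd ℂ) (q t))
    ((cont_e lam).mul (Complex.continuous_conj.comp hq_cont))
    (fun x => by rw [norm_mul, norm_e, RCLike.norm_conj, hq_abs, one_mul]) z
  obtain ⟨i4, s4, e4, b4⟩ := PP_main ha_cont ha_nonneg ha_int
    (PP2 lam ha_cont ha_nonneg ha_int hq_cont hq_abs)
    (u := fun t => (starRingEnd ℂ) (q t))
    (Complex.continuous_conj.comp hq_cont) (fun x => by rw [RCLike.norm_conj, hq_abs]) z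
  have c1 := bound_cosh b1
  have c4 := bound_cosh b4
  have c2 := bound_sinh b2
  have c3 := bound_sinh b3
  have E1 := congrArg (fun w => 1 - Complex.I * w) e1
  have E2 := congrArg (fun w => -Complex.I * w) e2
  have E3 := congrArg (fun w => Complex.I * w) e3
  have E4 := congrArg (fun w => 1 + Complex.I * w) e4
  simp only [← mul_assoc Complex.I z] at E1 E3 E4
  simp only [← mul_assoc (-Complex.I) z] at E2
  change aL1 q lam z = _ at E1
  change aL2 q lam z = _ at E2
  change aL3 q lam z = _ at E3
  change aL4 q lam z = _ at E4
  refine ⟨i1, i2, i3, i4, s1, E1, s2, E2, s3, E3, s4, E4, ?_, ?_, ?_, ?_⟩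
  · rw [E1]
    refine (norm_sub_le _ _).trans ?_
    simpa using c1
  · rw [E4]
    refine (norm_add_le _ _).trans ?_
    simpa using c4
  · rw [E2]
    simpa using c2
  · rw [E3]
    simpa using c3
end

section
/- The functions z ↦ a_{L1}(λ,z) and z ↦ a_{L4}(λ,z) are entire and even, the functions z ↦ a_{L2}(λ,z) and z ↦ a_{L3}(λ,z) are entire and odd, and for all z ∈ ℂ the symmetries a_{L1}(λ,z) = conj(a_{L4}(λ, conj(z))) and a_{L2}(λ,z) = conj(a_{L3}(λ, conj(z))) hold. -/
open MeasureTheory Set Filter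

namespace Aux4

noncomputable def B (a : ℝ → ℝ) (x : ℝ) : ℝ := ∫ y in Ioi x, a y

lemma norm_e (c r : ℝ) : ‖Complex.exp (2 * Complex.I * (c : ℂ) * (r : ℂ))‖ = 1 := by
  rw [Complex.norm_exp]
  simp

lemma norm_e1 (c r s : ℝ) :
    ‖Complex.exp (2 * Complex.I * (c : ℂ) * ((r : ℂ) - (s : ℂ)))‖ = 1 := by
  have := norm_e c (r - s)
  push_cast at this
  exact this

lemma norm_e2 (c r s : ℝ) :
    ‖Complex.exp (-(2 * Complex.I * (c : ℂ) * ((r : ℂ) - (s : ℂ))))‖ = 1 := by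
  rw [Complex.exp_neg, norm_inv, norm_e1, inv_one]

section
variable {a : ℝ → ℝ} (hc : Continuous a) (h0 : ∀ x, 0 ≤ a x) (hi : Integrable a)
include hi

lemma B_deriv (hc : Continuous a) (x : ℝ) : HasDerivAt (B a) (-a x) x := by
  have h : B a = fun x => B a 0 - ∫ y in (0:ℝ)..x, a y := by
    funext x
    have := intervalIntegral.integral_interval_add_Ioi (f := a) (μ := volume) (a := 0) (b := x)
      hi.integrableOn hi.integrableOn
    simp only [B]
    linarith
  rw [h]
  exact (hc.integral_hasStrictDerivAt 0 x).hasDerivAt.const_sub _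

omit hi in
lemma B_nonneg (h0 : ∀ x, 0 ≤ a x) (x : ℝ) : 0 ≤ B a x := integral_nonneg h0

lemma B_le (h0 : ∀ x, 0 ≤ a x) (x : ℝ) : B a x ≤ ∫ y, a y :=
  setIntegral_le_integral hi (Eventually.of_forall h0)

lemma step_int (hc : Continuous a) (h0 : ∀ x, 0 ≤ a x) (k : ℕ) (x : ℝ) :
    IntegrableOn (fun y => a y * (B a y ^ k / k.factorial)) (Ioi x) ∧
    ∫ y in Ioi x, a y * (B a y ^ k / k.factorial) = B a x ^ (k + 1) / (k + 1).factorial := by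
  have hd : ∀ y ∈ Ici x, HasDerivAt (fun y => - (B a y ^ (k + 1) / (k + 1).factorial))
      (a y * (B a y ^ k / k.factorial)) y := by
    intro y _
    have := (((B_deriv hi hc y).pow (k + 1)).div_const ((k + 1).factorial : ℝ)).neg
    refine HasDerivAt.congr_deriv this ?_
    rw [Nat.factorial_succ]
    have : (k.factorial : ℝ) ≠ 0 := by positivity
    have : (k + 1 : ℝ) ≠ 0 := by positivity
    push_cast
    field_simp
  have hp : ∀ y ∈ Ioi x, 0 ≤ a y * (B a y ^ k / k.factorial) := by
    intro y _
    have := h0 y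
    have := B_nonneg h0 y
    positivity
  have ht : Tendsto (fun y => - (B a y ^ (k + 1) / (k + 1).factorial)) atTop (nhds 0) := by
    have h1 : Tendsto (B a) atTop (nhds 0) := tendsto_integral_Ioi_zero tendsto_id
    have := ((h1.pow (k + 1)).div_const ((k + 1).factorial : ℝ)).neg
    simpa using this
  refine ⟨integrableOn_Ioi_deriv_of_nonneg' hd hp ht, ?_⟩
  rw [integral_Ioi_of_hasDerivAt_of_nonneg' hd hp ht]
  simp

lemma step_bd (hc : Continuous a) (h0 : ∀ x, 0 ≤ a x) (k : ℕ) (x : ℝ) (f : ℝ → ℂ)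
    (hf : ∀ y, ‖f y‖ ≤ a y * (B a y ^ k / k.factorial)) :
    ‖∫ y in Ioi x, f y‖ ≤ B a x ^ (k + 1) / (k + 1).factorial := by
  obtain ⟨h1, h2⟩ := step_int hi hc h0 k x
  rw [← h2]
  exact norm_integral_le_of_norm_le h1 (Eventually.of_forall hf)

lemma step2_bd (hc : Continuous a) (h0 : ∀ x, 0 ≤ a x) (k : ℕ) (x : ℝ) (f : ℝ → ℝ → ℂ)
    (m : ℝ → ℂ)
    (hm : ∀ t, ‖m t‖ ≤ B a t ^ k / k.factorial)
    (hf : ∀ y t, ‖f y t‖ = a y * a t * ‖m t‖) :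
    ‖∫ y in Ioi x, ∫ t in Ioi y, f y t‖ ≤ B a x ^ (k + 2) / (k + 2).factorial := by
  refine step_bd hi hc h0 (k + 1) x _ fun y => ?_
  obtain ⟨h1, h2⟩ := step_int hi hc h0 k y
  rw [← h2, ← integral_const_mul]
  refine norm_integral_le_of_norm_le (h1.const_mul _) (Eventually.of_forall fun t => ?_)
  rw [hf, mul_assoc]
  exact mul_le_mul_of_nonneg_left (mul_le_mul_of_nonneg_left (hm t) (h0 t)) (h0 y)

end

lemma mL1_bd {a : ℝ → ℝ} {q : ℝ → ℂ} (lam : ℝ) (hc : Continuous a) (h0 : ∀ x, 0 ≤ a x)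
    (hi : Integrable a) (hq : ∀ x, ‖q x‖ = a x) (n : ℕ) (x : ℝ) :
    ‖mL1 q lam n x‖ ≤ B a x ^ (2 * n) / (2 * n).factorial := by
  induction n generalizing x with
  | zero => simp [mL1]
  | succ n ih =>
    rw [mL1]
    refine step2_bd hi hc h0 (2 * n) x _ _ ih fun y t => ?_
    rw [norm_mul, norm_mul, norm_mul, norm_e1, RCLike.norm_conj, hq, hq, one_mul]

lemma mL2_bd {a : ℝ → ℝ} {q : ℝ → ℂ} (lam : ℝ) (hc : Continuous a) (h0 : ∀ x, 0 ≤ a x)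
    (hi : Integrable a) (hq : ∀ x, ‖q x‖ = a x) (n : ℕ) (x : ℝ) :
    ‖mL2 q lam n x‖ ≤ B a x ^ (2 * n + 1) / (2 * n + 1).factorial := by
  induction n generalizing x with
  | zero =>
    rw [mL2, norm_mul, norm_neg, Complex.norm_I, one_mul]
    refine step_bd hi hc h0 0 x _ fun y => ?_
    rw [norm_mul, norm_e2, hq]
    simp
  | succ n ih =>
    rw [mL2]
    refine step2_bd hi hc h0 (2 * n + 1) x _ _ ih fun y t => ?_
    rw [norm_mul, norm_mul, norm_mul, norm_e2, RCLike.norm_conj, hq, hq, one_mul]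

lemma meas_int {α : Type*} [MeasurableSpace α] (g : α → ℝ) (hg : Measurable g)
    (F : α → ℝ → ℂ) (hF : Measurable (fun p : α × ℝ => F p.1 p.2)) :
    Measurable (fun p => ∫ y in Ioi (g p), F p y) := by
  have h : (fun p => ∫ y in Ioi (g p), F p y) =
      fun p => ∫ y, (indicator {p : α × ℝ | g p.1 < p.2} (fun p => F p.1 p.2)) (p, y) := by
    funext p
    rw [← integral_indicator measurableSet_Ioi]
    rfl
  rw [h]
  refine (StronglyMeasurable.integral_prod_right' (Measurable.stronglyMeasurable ?_)).measurable
  exact hF.indicator (measurableSet_lt (by fun_prop) (by fun_prop))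

lemma mL1_meas {q : ℝ → ℂ} (lam : ℝ) (hq : Measurable q) (n : ℕ) : Measurable (mL1 q lam n) := by
  induction n with
  | zero =>
    have : mL1 q lam 0 = fun _ => 1 := by funext x; rw [mL1]
    rw [this]; exact measurable_const
  | succ n ih =>
    have : mL1 q lam (n + 1) = fun x : ℝ => ∫ y in Ioi x, (∫ t in Ioi y,
        Complex.exp (2 * Complex.I * (lam : ℂ) * ((t : ℂ) - (y : ℂ))) * q y *
          (starRingEnd ℂ) (q t) * mL1 q lam n t) := by funext x; rw [mL1]
    rw [this]
    refine meas_int _ measurable_id _ ?_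
    refine meas_int (fun p : ℝ × ℝ => p.2) measurable_snd _ ?_
    fun_prop

lemma mL2_meas {q : ℝ → ℂ} (lam : ℝ) (hq : Measurable q) (n : ℕ) : Measurable (mL2 q lam n) := by
  induction n with
  | zero =>
    have : mL2 q lam 0 = fun x : ℝ => -Complex.I * (∫ y in Ioi x,
        Complex.exp (-(2 * Complex.I * (lam : ℂ) * ((y : ℂ) - (x : ℂ)))) * q y) := by
      funext x; rw [mL2]
    rw [this]
    refine Measurable.const_mul (meas_int _ measurable_id _ ?_) _
    fun_prop
  | succ n ih =>
    have : mL2 q lam (n + 1) = fun x : ℝ => ∫ y in Ioi x, (∫ t in Ioi y,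
        Complex.exp (-(2 * Complex.I * (lam : ℂ) * ((y : ℂ) - (x : ℂ)))) * q y *
          (starRingEnd ℂ) (q t) * mL2 q lam n t) := by funext x; rw [mL2]
    rw [this]
    refine meas_int _ measurable_id _ ?_
    refine meas_int (fun p : ℝ × ℝ => p.2) measurable_snd _ ?_
    fun_prop

lemma key {a : ℝ → ℝ} (h0 : ∀ x, 0 ≤ a x) (hi : Integrable a) (w : ℝ → ℂ) (hw : Measurable w)
    (hwa : ∀ x, ‖w x‖ = a x) (m : ℕ → ℝ → ℂ) (hm : ∀ n, Measurable (m n))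
    (e : ℕ → ℕ) (he : Function.Injective e)
    (hb : ∀ n x, ‖m n x‖ ≤ B a x ^ (e n) / (e n).factorial) :
    Differentiable ℂ (fun z : ℂ => ∫ x, w x * ∑' n, m n x * z ^ (e n)) := by
  set A := ∫ y, a y with hA
  have hA0 : 0 ≤ A := integral_nonneg h0
  have hb' : ∀ n x, ‖m n x‖ ≤ A ^ (e n) / (e n).factorial := by
    intro n x
    refine (hb n x).trans ?_
    have := B_nonneg h0 x
    have := B_le hi h0 x
    gcongr
  have hsum : ∀ r : ℝ, Summable fun n => A * ((A * r) ^ (e n) / (e n).factorial) := fun r =>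
    ((Real.summable_pow_div_factorial (A * r)).comp_injective he).mul_left A
  have hbd : ∀ n (z : ℂ) x, ‖w x * (m n x * z ^ (e n))‖ ≤
      a x * ((A * ‖z‖) ^ (e n) / (e n).factorial) := by
    intro n z x
    rw [norm_mul, norm_mul, norm_pow, hwa]
    refine mul_le_mul_of_nonneg_left ?_ (h0 x)
    rw [mul_pow, mul_div_right_comm]
    exact mul_le_mul_of_nonneg_right (hb' n x) (by positivity)
  have hint : ∀ n (z : ℂ), Integrable (fun x => w x * (m n x * z ^ (e n))) := by
    intro n z
    refine (hi.mul_const ((A * ‖z‖) ^ (e n) / (e n).factorial)).mono' ?_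
      (Eventually.of_forall (hbd n z))
    have := hm n
    exact Measurable.aestronglyMeasurable (by fun_prop)
  have hI : ∀ n (z : ℂ), ∫ x, ‖w x * (m n x * z ^ (e n))‖ ≤
      A * ((A * ‖z‖) ^ (e n) / (e n).factorial) := by
    intro n z
    rw [hA, ← integral_mul_const]
    exact integral_mono (hint n z).norm (hi.mul_const _) (hbd n z)
  have hswap : (fun z : ℂ => ∫ x, w x * ∑' n, m n x * z ^ (e n)) =
      fun z => ∑' n, ∫ x, w x * (m n x * z ^ (e n)) := by
    funext z
    have := hasSum_integral_of_summable_integral_norm (fun n => hint n z)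
      (Summable.of_nonneg_of_le (fun n => integral_nonneg fun x => norm_nonneg _)
        (fun n => hI n z) (hsum ‖z‖))
    rw [this.tsum_eq]
    simp only [tsum_mul_left]
  rw [hswap]
  intro z
  have hD := Complex.differentiableOn_tsum_of_summable_norm
    (F := fun n z => ∫ x, w x * (m n x * z ^ (e n))) (U := Metric.ball 0 (‖z‖ + 1))
    (hsum (‖z‖ + 1)) ?_ Metric.isOpen_ball ?_
  · exact hD.differentiableAt (Metric.isOpen_ball.mem_nhds (by simp))
  · intro n
    have : (fun z : ℂ => ∫ x, w x * (m n x * z ^ (e n))) =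
        fun z => (∫ x, w x * m n x) * z ^ (e n) := by
      funext z
      rw [← integral_mul_const]
      simp only [mul_assoc]
    simp only [this]
    fun_prop
  · intro n u hu
    have hu' : ‖u‖ ≤ ‖z‖ + 1 := by simpa using (mem_ball_zero_iff.1 hu).le
    refine ((norm_integral_le_integral_norm _).trans (hI n u)).trans ?_
    gcongr

lemma conj_exp (c : ℝ) (u : ℂ) (hu : (starRingEnd ℂ) u = u) :
    (starRingEnd ℂ) (Complex.exp (2 * Complex.I * (c : ℂ) * u)) =
      Complex.exp (-(2 * Complex.I * (c : ℂ) * u)) := by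
  rw [← Complex.exp_conj]
  simp [hu, map_ofNat]

lemma conj_exp' (c : ℝ) (u : ℂ) (hu : (starRingEnd ℂ) u = u) :
    (starRingEnd ℂ) (Complex.exp (-(2 * Complex.I * (c : ℂ) * u))) =
      Complex.exp (2 * Complex.I * (c : ℂ) * u) := by
  rw [← conj_exp c u hu, Complex.conj_conj]

lemma mL4_eq (q : ℝ → ℂ) (lam : ℝ) (n : ℕ) (x : ℝ) :
    mL4 q lam n x = (starRingEnd ℂ) (mL1 q lam n x) := by
  induction n generalizing x with
  | zero => simp [mL4, mL1]
  | succ n ih =>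
    rw [mL4, mL1]
    simp only [← integral_conj, map_mul, ih, Complex.conj_conj]
    congr! 7 with y t
    refine (conj_exp _ _ ?_).symm
    simp

lemma mL3_eq (q : ℝ → ℂ) (lam : ℝ) (n : ℕ) (x : ℝ) :
    mL3 q lam n x = (starRingEnd ℂ) (mL2 q lam n x) := by
  induction n generalizing x with
  | zero =>
    rw [mL3, mL2]
    simp only [← integral_conj, map_mul, map_neg, Complex.conj_I, neg_neg]
    congr! 4 with y
    refine (conj_exp' _ _ ?_).symm
    simp
  | succ n ih =>
    rw [mL3, mL2]
    simp only [← integral_conj, map_mul, ih, Complex.conj_conj]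
    congr! 7 with y t
    refine (conj_exp' _ _ ?_).symm
    simp

lemma ML4_eq (q : ℝ → ℂ) (lam : ℝ) (x : ℝ) (z : ℂ) :
    ML4 q lam x z = (starRingEnd ℂ) (ML1 q lam x ((starRingEnd ℂ) z)) := by
  rw [ML4, ML1, Complex.conj_tsum]
  simp [mL4_eq]

lemma ML3_eq (q : ℝ → ℂ) (lam : ℝ) (x : ℝ) (z : ℂ) :
    ML3 q lam x z = (starRingEnd ℂ) (ML2 q lam x ((starRingEnd ℂ) z)) := by
  rw [ML3, ML2, Complex.conj_tsum]
  simp [mL3_eq]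

lemma aL1_eq (q : ℝ → ℂ) (lam : ℝ) (z : ℂ) :
    aL1 q lam z = (starRingEnd ℂ) (aL4 q lam ((starRingEnd ℂ) z)) := by
  rw [aL1, aL4]
  simp only [map_add, map_mul, map_one, ← integral_conj, Complex.conj_conj, Complex.conj_I, ML3_eq]
  ring

lemma aL2_eq (q : ℝ → ℂ) (lam : ℝ) (z : ℂ) :
    aL2 q lam z = (starRingEnd ℂ) (aL3 q lam ((starRingEnd ℂ) z)) := by
  rw [aL2, aL3]
  simp only [map_mul, ← integral_conj, Complex.conj_conj, Complex.conj_I, ML4_eq]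
  congr! 5 with x
  refine (conj_exp _ _ ?_).symm
  simp

lemma aL3_odd (q : ℝ → ℂ) (lam : ℝ) (z : ℂ) : aL3 q lam (-z) = -aL3 q lam z := by
  have : ∀ x, ML1 q lam x (-z) = ML1 q lam x z := by
    intro x
    simp [ML1, pow_mul]
  simp [aL3, this]

lemma aL4_even (q : ℝ → ℂ) (lam : ℝ) (z : ℂ) : aL4 q lam (-z) = aL4 q lam z := by
  have : ∀ x, ML2 q lam x (-z) = - ML2 q lam x z := by
    intro x
    simp [ML2, pow_succ, pow_mul, tsum_neg]
  simp [aL4, this, integral_neg]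

end Aux4

theorem stmt4
    (a : ℝ → ℝ) (q : ℝ → ℂ) (lam : ℝ)
    (ha_cont : Continuous a) (ha_nonneg : ∀ x, 0 ≤ a x) (ha_int : Integrable a)
    (hq_cont : Continuous q) (hq_abs : ∀ x, ‖q x‖ = a x) :
    Differentiable ℂ (aL1 q lam) ∧
    Differentiable ℂ (aL2 q lam) ∧
    Differentiable ℂ (aL3 q lam) ∧
    Differentiable ℂ (aL4 q lam) ∧
    (∀ z : ℂ, aL1 q lam (-z) = aL1 q lam z) ∧
    (∀ z : ℂ, aL4 q lam (-z) = aL4 q lam z) ∧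
    (∀ z : ℂ, aL2 q lam (-z) = -aL2 q lam z) ∧
    (∀ z : ℂ, aL3 q lam (-z) = -aL3 q lam z) ∧
    (∀ z : ℂ, aL1 q lam z = (starRingEnd ℂ) (aL4 q lam ((starRingEnd ℂ) z))) ∧
    (∀ z : ℂ, aL2 q lam z = (starRingEnd ℂ) (aL3 q lam ((starRingEnd ℂ) z))) := by
  have hqm : Measurable q := hq_cont.measurable
  have d3 : Differentiable ℂ (aL3 q lam) := by
    have := Aux4.key ha_nonneg ha_int
      (fun x => Complex.exp (2 * Complex.I * (lam : ℂ) * (x : ℂ)) * (starRingEnd ℂ) (q x))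
      (by fun_prop) (fun x => by rw [norm_mul, Aux4.norm_e, RCLike.norm_conj, hq_abs, one_mul])
      (mL1 q lam) (Aux4.mL1_meas lam hqm) (fun n => 2 * n) (fun i j h => by simpa using h)
      (Aux4.mL1_bd lam ha_cont ha_nonneg ha_int hq_abs)
    exact (differentiable_id.const_mul Complex.I).mul this
  have d4 : Differentiable ℂ (aL4 q lam) := by
    have := Aux4.key ha_nonneg ha_int
      (fun x => (starRingEnd ℂ) (q x))
      (by fun_prop) (fun x => by rw [RCLike.norm_conj, hq_abs])
      (mL2 q lam) (Aux4.mL2_meas lam hqm) (fun n => 2 * n + 1) (fun i j h => by simpa using h)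
      (Aux4.mL2_bd lam ha_cont ha_nonneg ha_int hq_abs)
    exact ((differentiable_id.const_mul Complex.I).mul this).const_add 1
  have d1 : Differentiable ℂ (aL1 q lam) := by
    have h : aL1 q lam = starRingEnd ℂ ∘ aL4 q lam ∘ starRingEnd ℂ := funext (Aux4.aL1_eq q lam)
    intro z
    rw [h, differentiableAt_conj_conj_iff]
    exact d4 _
  have d2 : Differentiable ℂ (aL2 q lam) := by
    have h : aL2 q lam = starRingEnd ℂ ∘ aL3 q lam ∘ starRingEnd ℂ := funext (Aux4.aL2_eq q lam)
    intro z
    rw [h, differentiableAt_conj_conj_iff]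
    exact d3 _
  refine ⟨d1, d2, d3, d4, ?_, Aux4.aL4_even q lam, ?_, Aux4.aL3_odd q lam, Aux4.aL1_eq q lam,
    Aux4.aL2_eq q lam⟩
  · intro z
    rw [Aux4.aL1_eq, Aux4.aL1_eq, map_neg, Aux4.aL4_even]
  · intro z
    rw [Aux4.aL2_eq, Aux4.aL2_eq, map_neg, Aux4.aL3_odd, map_neg]
end

section
/- For all z ∈ ℂ the following relations hold: a_{L1}(λ,z)·conj(a_{L1}(λ, conj(z))) − a_{L3}(λ,z)·conj(a_{L3}(λ, conj(z))) = 1 and a_{L4}(λ,z)·conj(a_{L4}(λ, conj(z))) − a_{L2}(λ,z)·conj(a_{L2}(λ, conj(z))) = 1. In particular, for every real z, |a_{L1}(λ,z)|² = 1 + |a_{L3}(λ,z)|² ≥ 1, so a_{L1}(λ,z) ≠ 0 for real z. -/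
open MeasureTheory Set Filter

theorem tail_hasDerivAt {g : ℝ → ℂ} (hc : Continuous g) (hi : Integrable g) (x : ℝ) :
    HasDerivAt (fun x => ∫ t in Ioi x, g t) (-g x) x := by
  have h1 : (fun x => ∫ t in Ioi x, g t) = fun x => (∫ t in Ioi (0:ℝ), g t) - ∫ t in (0:ℝ)..x, g t := by
    funext x
    rw [← intervalIntegral.integral_Ioi_sub_Ioi' hi.integrableOn hi.integrableOn]
    ring
  rw [h1]
  exact (intervalIntegral.integral_hasDerivAt_right (hc.intervalIntegrable _ _)
    (hc.stronglyMeasurableAtFilter _ _) hc.continuousAt).const_sub _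

theorem tail_tendsto_atTop {g : ℝ → ℂ} (hi : Integrable g) :
    Tendsto (fun x => ∫ t in Ioi x, g t) atTop (nhds 0) := by
  have h2 := intervalIntegral_tendsto_integral_Ioi 0 hi.integrableOn tendsto_id
  have h3 := h2.const_sub (∫ t in Ioi (0:ℝ), g t)
  rw [sub_self] at h3
  refine h3.congr fun x => ?_
  simp only [id]
  rw [← intervalIntegral.integral_Ioi_sub_Ioi' hi.integrableOn hi.integrableOn]
  ring

theorem tail_tendsto_atBot {g : ℝ → ℂ} (hi : Integrable g) :
    Tendsto (fun x => ∫ t in Ioi x, g t) atBot (nhds (∫ t, g t)) := by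
  have h2 := intervalIntegral_tendsto_integral_Iic 0 hi.integrableOn tendsto_id
  have h3 := h2.add_const (∫ t in Ioi (0:ℝ), g t)
  rw [intervalIntegral.integral_Iic_add_Ioi hi.integrableOn hi.integrableOn] at h3
  refine h3.congr fun x => ?_
  simp only [id]
  rw [← intervalIntegral.integral_Ioi_sub_Ioi' hi.integrableOn hi.integrableOn]
  ring

noncomputable def EE (w : ℕ → ℝ → ℂ) : ℕ → ℝ → ℂ
  | 0, _ => 1
  | n + 1, x => ∫ t in Ioi x, w n t * EE w n t

theorem EE_succ (w : ℕ → ℝ → ℂ) (n : ℕ) (x : ℝ) :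
    EE w (n + 1) x = ∫ t in Ioi x, w n t * EE w n t := rfl

section
variable {a : ℝ → ℝ} {w : ℕ → ℝ → ℂ}

theorem real_tail_hasDerivAt {g : ℝ → ℝ} (hc : Continuous g) (hi : Integrable g) (x : ℝ) :
    HasDerivAt (fun x => ∫ t in Ioi x, g t) (-g x) x := by
  have h1 : (fun x => ∫ t in Ioi x, g t) = fun x => (∫ t in Ioi (0:ℝ), g t) - ∫ t in (0:ℝ)..x, g t := by
    funext x
    rw [← intervalIntegral.integral_Ioi_sub_Ioi' hi.integrableOn hi.integrableOn]
    ring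
  rw [h1]
  exact (intervalIntegral.integral_hasDerivAt_right (hc.intervalIntegrable _ _)
    (hc.stronglyMeasurableAtFilter _ _) hc.continuousAt).const_sub _

theorem real_tail_tendsto_atTop {g : ℝ → ℝ} (hi : Integrable g) :
    Tendsto (fun x => ∫ t in Ioi x, g t) atTop (nhds 0) := by
  have h2 := intervalIntegral_tendsto_integral_Ioi 0 hi.integrableOn tendsto_id
  have h3 := h2.const_sub (∫ t in Ioi (0:ℝ), g t)
  rw [sub_self] at h3
  refine h3.congr fun x => ?_
  simp only [id]
  rw [← intervalIntegral.integral_Ioi_sub_Ioi' hi.integrableOn hi.integrableOn]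
  ring

theorem mul_int (hi : Integrable a) {u g : ℝ → ℂ} (hu : Continuous u)
    (hua : ∀ x, ‖u x‖ = a x) (hg : Continuous g) {C : ℝ} (hC : ∀ x, ‖g x‖ ≤ C) :
    Integrable (fun x => u x * g x) := by
  have hui : Integrable u := by
    refine hi.mono' hu.aestronglyMeasurable (ae_of_all _ fun x => (hua x).le)
  exact hui.mul_bdd hg.aestronglyMeasurable (ae_of_all _ hC)

theorem EE_main (hc : Continuous a) (h0 : ∀ x, 0 ≤ a x) (hi : Integrable a)
    (hw : ∀ n, Continuous (w n)) (hwa : ∀ n x, ‖w n x‖ = a x) (n : ℕ) :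
    Continuous (EE w n) ∧ (∀ x, ‖EE w n x‖ ≤ (∫ t in Ioi x, a t) ^ n / n.factorial) ∧
     (∀ x, ‖EE w n x‖ ≤ (∫ t, a t) ^ n / n.factorial) := by
  have hB0 : ∀ x, 0 ≤ ∫ t in Ioi x, a t := fun x => setIntegral_nonneg measurableSet_Ioi fun t _ => h0 t
  have hBA : ∀ x, ∫ t in Ioi x, a t ≤ ∫ t, a t := fun x =>
    setIntegral_le_integral hi (ae_of_all _ h0)
  suffices h : Continuous (EE w n) ∧ (∀ x, ‖EE w n x‖ ≤ (∫ t in Ioi x, a t) ^ n / n.factorial) by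
    refine ⟨h.1, h.2, fun x => (h.2 x).trans ?_⟩
    have := hB0 x
    have := hBA x
    gcongr
  induction n with
  | zero => exact ⟨continuous_const, fun x => by simp [EE]⟩
  | succ n ih =>
    obtain ⟨ihc, ihb⟩ := ih
    have hint : Integrable (fun x => w n x * EE w n x) := by
      refine mul_int hi (hw n) (hwa n) ihc (C := (∫ t, a t) ^ n / n.factorial) fun x => (ihb x).trans ?_
      have := hB0 x
      have := hBA x
      gcongr
    have hcc : Continuous (fun x => w n x * EE w n x) := (hw n).mul ihc
    refine ⟨?_, fun x => ?_⟩
    · have : EE w (n+1) = fun x => ∫ t in Ioi x, w n t * EE w n t := rfl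
      rw [this]
      exact continuous_iff_continuousAt.2 fun x => (tail_hasDerivAt hcc hint x).continuousAt
    · have hd : ∀ y, HasDerivAt (fun x => -((∫ t in Ioi x, a t) ^ (n+1) / (n+1).factorial))
          (a y * ((∫ t in Ioi y, a t) ^ n / n.factorial)) y := by
        intro y
        have := (((real_tail_hasDerivAt hc hi y).pow (n+1)).div_const ((n+1).factorial : ℝ)).neg
        refine this.congr_deriv ?_
        have hn : (n.factorial : ℝ) ≠ 0 := by positivity
        have hn' : (n : ℝ) + 1 ≠ 0 := by positivity
        rw [Nat.factorial_succ]
        push_cast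
        field_simp
      have ht : Tendsto (fun x => -((∫ t in Ioi x, a t) ^ (n+1) / (n+1).factorial)) atTop (nhds 0) := by
        have := (((real_tail_tendsto_atTop hi).pow (n+1)).div_const ((n+1).factorial : ℝ)).neg
        simpa using this
      have hnn : ∀ y ∈ Ioi x, 0 ≤ a y * ((∫ t in Ioi y, a t) ^ n / n.factorial) := fun y _ => by
        have := hB0 y
        have := h0 y
        positivity
      have e := integral_Ioi_of_hasDerivAt_of_nonneg' (a := x) (fun y _ => hd y) hnn ht
      have ei := integrableOn_Ioi_deriv_of_nonneg' (a := x) (fun y _ => hd y) hnn ht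
      rw [zero_sub, neg_neg] at e
      rw [← e]
      refine norm_integral_le_of_norm_le ei (ae_of_all _ fun t => ?_)
      rw [norm_mul, hwa]
      exact mul_le_mul_of_nonneg_left (ihb t) (h0 t)

/-- sum / integral exchange -/
theorem exch (hi : Integrable a) {u : ℝ → ℂ} (hu : Continuous u)
    (hua : ∀ x, ‖u x‖ = a x) {f : ℕ → ℝ → ℂ} (hf : ∀ n, Continuous (f n)) {C : ℕ → ℝ}
    (hC : ∀ n x, ‖f n x‖ ≤ C n) (hs : Summable C) (s : Set ℝ) :
    ∫ t in s, u t * ∑' n, f n t = ∑' n, ∫ t in s, u t * f n t := by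
  have hin : ∀ n, Integrable (fun t => u t * f n t) := fun n => mul_int hi hu hua (hf n) (hC n)
  rw [integral_tsum_of_summable_integral_norm (fun n => (hin n).integrableOn)]
  · simp_rw [tsum_mul_left]
  · refine Summable.of_nonneg_of_le (fun n => integral_nonneg fun t => norm_nonneg _) (fun n => ?_)
      (hs.mul_left (∫ t in s, a t))
    rw [← integral_mul_const]
    refine integral_mono (hin n).norm.integrableOn (hi.integrableOn.mul_const _) fun t => ?_
    simp only [norm_mul, hua]
    exact mul_le_mul_of_nonneg_left (hC n t) (by rw [← hua t]; positivity)
end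

section
variable {q : ℝ → ℂ} {lam : ℝ}

noncomputable def QQ (q : ℝ → ℂ) (lam : ℝ) (x : ℝ) : ℂ :=
  Complex.exp (-(2 * Complex.I * (lam : ℂ) * (x : ℂ))) * q x
noncomputable def QC (q : ℝ → ℂ) (lam : ℝ) (x : ℝ) : ℂ :=
  Complex.exp (2 * Complex.I * (lam : ℂ) * (x : ℂ)) * (starRingEnd ℂ) (q x)
noncomputable def ww (q : ℝ → ℂ) (lam : ℝ) (n : ℕ) : ℝ → ℂ :=
  if Even n then QC q lam else QQ q lam

theorem QC_eq (x : ℝ) : QC q lam x = (starRingEnd ℂ) (QQ q lam x) := by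
  simp [QC, QQ, ← Complex.exp_conj, Complex.conj_ofNat]

theorem QQ_norm (x : ℝ) : ‖QQ q lam x‖ = ‖q x‖ := by
  simp [QQ, Complex.norm_exp]

theorem QC_norm (x : ℝ) : ‖QC q lam x‖ = ‖q x‖ := by
  rw [QC_eq, RCLike.norm_conj, QQ_norm]

theorem ww_even (n : ℕ) : ww q lam (2 * n) = QC q lam := by simp [ww]
theorem ww_odd (n : ℕ) : ww q lam (2 * n + 1) = QQ q lam := by simp [ww]

theorem mL1_eq (n : ℕ) : ∀ x, mL1 q lam n x = EE (ww q lam) (2 * n) x := by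
  induction n with
  | zero => intro x; simp [mL1, EE]
  | succ n ih =>
    intro x
    rw [show 2 * (n+1) = 2 * n + 1 + 1 by ring]
    simp only [mL1, EE, ww_even, ww_odd]
    congr 1; funext y
    rw [← integral_const_mul]
    congr 1; funext t
    rw [ih]
    simp only [QQ, QC]
    rw [show 2 * Complex.I * (lam : ℂ) * ((t : ℂ) - (y : ℂ)) =
      -(2 * Complex.I * (lam : ℂ) * (y : ℂ)) + 2 * Complex.I * (lam : ℂ) * (t : ℂ) by ring, Complex.exp_add]
    ring

theorem mL3_eq (n : ℕ) : ∀ x, mL3 q lam n x =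
    Complex.I * Complex.exp (-(2 * Complex.I * (lam : ℂ) * (x : ℂ))) * EE (ww q lam) (2 * n + 1) x := by
  induction n with
  | zero =>
    intro x
    simp only [mL3, EE]
    rw [mul_assoc Complex.I (Complex.exp _), ← integral_const_mul (Complex.exp _)]
    congr 2; funext y
    rw [ww_even 0]
    simp only [QC]
    rw [show 2 * Complex.I * (lam : ℂ) * ((y : ℂ) - (x : ℂ)) =
      -(2 * Complex.I * (lam : ℂ) * (x : ℂ)) + 2 * Complex.I * (lam : ℂ) * (y : ℂ) by ring, Complex.exp_add]
    ring
  | succ n ih =>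
    intro x
    rw [show 2 * (n+1) + 1 = 2 * n + 1 + 1 + 1 by ring]
    rw [EE_succ, mL3]
    simp only [EE_succ _ (2 * n + 1)]
    rw [← integral_const_mul]
    congr 1; funext y
    rw [← integral_const_mul, ← integral_const_mul]
    congr 1; funext t
    rw [ih, show 2 * n + 1 + 1 = 2 * (n+1) by ring, ww_even, ww_odd]
    simp only [QQ, QC]
    rw [show 2 * Complex.I * (lam : ℂ) * ((y : ℂ) - (x : ℂ)) =
      -(2 * Complex.I * (lam : ℂ) * (x : ℂ)) + 2 * Complex.I * (lam : ℂ) * (y : ℂ) by ring, Complex.exp_add]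
    ring

noncomputable def MM (q : ℝ → ℂ) (lam : ℝ) (z : ℂ) (x : ℝ) : ℂ :=
  ∑' n : ℕ, EE (ww q lam) (2 * n) x * z ^ (2 * n)
noncomputable def NN (q : ℝ → ℂ) (lam : ℝ) (z : ℂ) (x : ℝ) : ℂ :=
  ∑' n : ℕ, EE (ww q lam) (2 * n + 1) x * z ^ (2 * n + 1)

theorem ML1_eq (x : ℝ) (z : ℂ) : ML1 q lam x z = MM q lam z x := by
  simp [ML1, MM, mL1_eq]

theorem ML3_eq (x : ℝ) (z : ℂ) : ML3 q lam x z =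
    Complex.I * Complex.exp (-(2 * Complex.I * (lam : ℂ) * (x : ℂ))) * NN q lam z x := by
  simp only [ML3, NN, mL3_eq]
  rw [← tsum_mul_left]
  congr 1; funext n; ring

theorem aL1_eq (z : ℂ) : aL1 q lam z = 1 + z * ∫ x, QQ q lam x * NN q lam z x := by
  rw [aL1, show (∫ x, q x * ML3 q lam x z) = Complex.I * ∫ x, QQ q lam x * NN q lam z x by
    rw [← integral_const_mul]
    congr 1; funext x
    rw [ML3_eq, QQ]; ring]
  linear_combination (-z * ∫ x, QQ q lam x * NN q lam z x) * Complex.I_mul_I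

theorem aL3_eq (z : ℂ) : aL3 q lam z = Complex.I * z * ∫ x, QC q lam x * MM q lam z x := by
  simp only [aL3, ML1_eq, QC]

theorem main1 (a : ℝ → ℝ)
    (ha_cont : Continuous a) (ha_nonneg : ∀ x, 0 ≤ a x) (ha_int : Integrable a)
    (hq_cont : Continuous q) (hq_abs : ∀ x, ‖q x‖ = a x) (z : ℂ) :
      aL1 q lam z * (starRingEnd ℂ) (aL1 q lam ((starRingEnd ℂ) z)) -
        aL3 q lam z * (starRingEnd ℂ) (aL3 q lam ((starRingEnd ℂ) z)) = 1 := by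
  have hQ : Continuous (QQ q lam) := by unfold QQ; fun_prop
  have hQC : Continuous (QC q lam) := by
    have : QC q lam = fun x => (starRingEnd ℂ) (QQ q lam x) := funext QC_eq
    rw [this]; exact Complex.continuous_conj.comp hQ
  have hQa : ∀ x, ‖QQ q lam x‖ = a x := fun x => by rw [QQ_norm, hq_abs]
  have hQCa : ∀ x, ‖QC q lam x‖ = a x := fun x => by rw [QC_norm, hq_abs]
  have hw : ∀ n, Continuous (ww q lam n) := fun n => by unfold ww; split_ifs <;> assumption
  have hwa : ∀ n x, ‖ww q lam n x‖ = a x := fun n => by unfold ww; split_ifs <;> assumption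
  have hE := EE_main ha_cont ha_nonneg ha_int hw hwa
  set A := ∫ t, a t with hA
  have hb : ∀ (z : ℂ) n x, ‖EE (ww q lam) n x * z ^ n‖ ≤ (A * ‖z‖) ^ n / n.factorial := by
    intro z n x
    rw [norm_mul, norm_pow, mul_pow, mul_div_right_comm]
    exact mul_le_mul_of_nonneg_right ((hE n).2.2 x) (by positivity)
  have hcn : ∀ (z : ℂ) n, Continuous fun x => EE (ww q lam) n x * z ^ n := fun z n =>
    (hE n).1.mul continuous_const
  have hS : ∀ z : ℂ, Summable fun n : ℕ => (A * ‖z‖) ^ n / n.factorial := fun z =>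
    Real.summable_pow_div_factorial _
  have hSe : ∀ z : ℂ, Summable fun n : ℕ => (A * ‖z‖) ^ (2 * n) / (2 * n).factorial := fun z =>
    (hS z).comp_injective (i := fun n => 2 * n) fun m n h => by simpa using h
  have hSo : ∀ z : ℂ, Summable fun n : ℕ => (A * ‖z‖) ^ (2 * n + 1) / (2 * n + 1).factorial := fun z =>
    (hS z).comp_injective (i := fun n => 2 * n + 1) fun m n h => by simpa using h
  have hMc : ∀ z, Continuous (MM q lam z) := fun z =>
    continuous_tsum (fun n => hcn z (2 * n)) (hSe z) fun n x => hb z _ x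
  have hNc : ∀ z, Continuous (NN q lam z) := fun z =>
    continuous_tsum (fun n => hcn z (2 * n + 1)) (hSo z) fun n x => hb z _ x
  have hMb : ∀ z x, ‖MM q lam z x‖ ≤ ∑' n : ℕ, (A * ‖z‖) ^ (2 * n) / (2 * n).factorial := fun z x =>
    tsum_of_norm_bounded (hSe z).hasSum fun n => hb z _ x
  have hNb : ∀ z x, ‖NN q lam z x‖ ≤ ∑' n : ℕ, (A * ‖z‖) ^ (2 * n + 1) / (2 * n + 1).factorial := fun z x =>
    tsum_of_norm_bounded (hSo z).hasSum fun n => hb z _ x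
  have hMi : ∀ z, Integrable fun x => QC q lam x * MM q lam z x := fun z =>
    mul_int ha_int hQC hQCa (hMc z) (hMb z)
  have hNi : ∀ z, Integrable fun x => QQ q lam x * NN q lam z x := fun z =>
    mul_int ha_int hQ hQa (hNc z) (hNb z)
  have hNeq : ∀ z, NN q lam z = fun x => z * ∫ t in Ioi x, QC q lam t * MM q lam z t := by
    intro z; funext x
    simp only [MM]
    rw [exch ha_int hQC hQCa (fun n => hcn z (2 * n)) (fun n x => hb z _ x) (hSe z), ← tsum_mul_left, NN]
    congr 1; funext n
    rw [EE, ww_even, ← integral_mul_const, ← integral_const_mul]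
    congr 1; funext t
    ring
  have hMeq : ∀ z, MM q lam z = fun x => 1 + z * ∫ t in Ioi x, QQ q lam t * NN q lam z t := by
    intro z; funext x
    simp only [NN]
    rw [exch ha_int hQ hQa (fun n => hcn z (2 * n + 1)) (fun n x => hb z _ x) (hSo z), ← tsum_mul_left, MM,
      Summable.tsum_eq_zero_add (Summable.of_norm_bounded (hSe z) fun n => hb z _ x)]
    congr 1
    · simp [EE]
    congr 1; funext n
    rw [show 2 * (n + 1) = 2 * n + 1 + 1 by ring, EE, ww_odd, ← integral_mul_const, ← integral_const_mul]
    congr 1; funext t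
    ring
  have hNd : ∀ z x, HasDerivAt (NN q lam z) (z * -(QC q lam x * MM q lam z x)) x := by
    intro z x
    have := (tail_hasDerivAt (g := fun x => QC q lam x * MM q lam z x) (hQC.mul (hMc z)) (hMi z) x).const_mul z
    rwa [← hNeq z] at this
  have hMd : ∀ z x, HasDerivAt (MM q lam z) (z * -(QQ q lam x * NN q lam z x)) x := by
    intro z x
    have := ((tail_hasDerivAt (g := fun x => QQ q lam x * NN q lam z x) (hQ.mul (hNc z)) (hNi z) x).const_mul z).const_add 1
    rwa [← hMeq z] at this
  have hNt : ∀ z, Tendsto (NN q lam z) atTop (nhds 0) := by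
    intro z
    have := (tail_tendsto_atTop (hMi z)).const_mul z
    rwa [← hNeq z, mul_zero] at this
  have hMt : ∀ z, Tendsto (MM q lam z) atTop (nhds 1) := by
    intro z
    have := ((tail_tendsto_atTop (hNi z)).const_mul z).const_add 1
    rwa [← hMeq z, mul_zero, add_zero] at this
  have hNbot : ∀ z, Tendsto (NN q lam z) atBot (nhds (z * ∫ x, QC q lam x * MM q lam z x)) := by
    intro z
    have := (tail_tendsto_atBot (hMi z)).const_mul z
    rwa [← hNeq z] at this
  have hMbot : ∀ z, Tendsto (MM q lam z) atBot (nhds (aL1 q lam z)) := by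
    intro z
    have := ((tail_tendsto_atBot (hNi z)).const_mul z).const_add 1
    rwa [← hMeq z, ← aL1_eq] at this
  set z' := (starRingEnd ℂ) z with hz'
  let W : ℝ → ℂ := fun x => MM q lam z x * star (MM q lam z' x) - NN q lam z x * star (NN q lam z' x)
  have hWd : ∀ x, HasDerivAt W 0 x := by
    intro x
    have := ((hMd z x).mul (hMd z' x).star).sub ((hNd z x).mul (hNd z' x).star)
    refine this.congr_deriv ?_
    simp only [QC_eq, hz', star_mul', star_neg, Complex.star_def, Complex.conj_conj]
    ring
  have hconst : ∀ x, W x = W 0 := fun x =>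
    is_const_of_deriv_eq_zero (fun x => (hWd x).differentiableAt) (fun x => (hWd x).deriv) x 0
  have hWc : W = fun _ => W 0 := funext hconst
  have t1 : Tendsto W atTop (nhds (1 * star 1 - 0 * star 0)) :=
    ((hMt z).mul (hMt z').star).sub ((hNt z).mul (hNt z').star)
  have t2 := ((hMbot z).mul (hMbot z').star).sub ((hNbot z).mul (hNbot z').star)
  change Tendsto W atBot _ at t2
  rw [hWc] at t1 t2
  have e1 := tendsto_nhds_unique t1 tendsto_const_nhds
  have e2 := tendsto_nhds_unique t2 tendsto_const_nhds
  rw [← e1] at e2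
  simp only [star_one, star_zero, mul_zero, sub_zero, mul_one, Complex.star_def] at e2
  rw [← e2, aL3_eq, aL3_eq]
  simp only [map_mul, Complex.conj_I]
  linear_combination (((z * ∫ x, QC q lam x * MM q lam z x) * ((starRingEnd ℂ) z' * (starRingEnd ℂ) (∫ x, QC q lam x * MM q lam z' x)))) * Complex.I_mul_I

theorem mL4_eq (n : ℕ) : ∀ x, mL4 q lam n x = mL1 (fun y => (starRingEnd ℂ) (q y)) (-lam) n x := by
  induction n with
  | zero => intro x; simp [mL4, mL1]
  | succ n ih =>
    intro x
    simp only [mL4, mL1, ih, Complex.conj_conj, Complex.ofReal_neg, mul_neg, neg_mul]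

theorem mL2_eq (n : ℕ) : ∀ x, mL2 q lam n x = -mL3 (fun y => (starRingEnd ℂ) (q y)) (-lam) n x := by
  induction n with
  | zero => intro x; simp only [mL2, mL3, Complex.conj_conj, Complex.ofReal_neg, mul_neg, neg_mul]
  | succ n ih =>
    intro x
    simp only [mL2, mL3, ih, Complex.conj_conj, Complex.ofReal_neg, mul_neg, neg_mul, integral_neg]

theorem aL4_eq (z : ℂ) : aL4 q lam z = aL1 (fun y => (starRingEnd ℂ) (q y)) (-lam) z := by
  simp only [aL4, aL1, ML2, ML3, mL2_eq, mul_neg, neg_mul, tsum_neg, integral_neg, sub_eq_add_neg]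

theorem aL2_eq (z : ℂ) : aL2 q lam z = -aL3 (fun y => (starRingEnd ℂ) (q y)) (-lam) z := by
  simp only [aL2, aL3, ML4, ML1, mL4_eq, mul_neg, neg_mul, Complex.conj_conj, Complex.ofReal_neg]
end

theorem stmt5
    (a : ℝ → ℝ) (q : ℝ → ℂ) (lam : ℝ)
    (ha_cont : Continuous a) (ha_nonneg : ∀ x, 0 ≤ a x) (ha_int : Integrable a)
    (hq_cont : Continuous q) (hq_abs : ∀ x, ‖q x‖ = a x) :
    (∀ z : ℂ,
      aL1 q lam z * (starRingEnd ℂ) (aL1 q lam ((starRingEnd ℂ) z)) -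
        aL3 q lam z * (starRingEnd ℂ) (aL3 q lam ((starRingEnd ℂ) z)) = 1) ∧
    (∀ z : ℂ,
      aL4 q lam z * (starRingEnd ℂ) (aL4 q lam ((starRingEnd ℂ) z)) -
        aL2 q lam z * (starRingEnd ℂ) (aL2 q lam ((starRingEnd ℂ) z)) = 1) ∧
    ∀ t : ℝ,
      ‖aL1 q lam (t : ℂ)‖ ^ 2 = 1 + ‖aL3 q lam (t : ℂ)‖ ^ 2 ∧
      1 ≤ ‖aL1 q lam (t : ℂ)‖ ^ 2 ∧
      aL1 q lam (t : ℂ) ≠ 0 := by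
  have H1 := fun z => main1 (lam := lam) a ha_cont ha_nonneg ha_int hq_cont hq_abs z
  refine ⟨H1, fun z => ?_, fun t => ?_⟩
  · have := main1 (q := fun y => (starRingEnd ℂ) (q y)) (lam := -lam) a ha_cont ha_nonneg ha_int
      (Complex.continuous_conj.comp hq_cont) (fun x => by rw [RCLike.norm_conj, hq_abs]) z
    rw [aL4_eq, aL4_eq, aL2_eq, aL2_eq, map_neg, neg_mul_neg]
    exact this
  · have h := H1 (t : ℂ)
    rw [Complex.conj_ofReal, Complex.mul_conj, Complex.mul_conj, Complex.normSq_eq_norm_sq,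
      Complex.normSq_eq_norm_sq] at h
    have h' : ‖aL1 q lam (t : ℂ)‖ ^ 2 - ‖aL3 q lam (t : ℂ)‖ ^ 2 = 1 := by exact_mod_cast h
    have h3 := sq_nonneg ‖aL3 q lam (t : ℂ)‖
    refine ⟨by linarith, by linarith, fun h0 => ?_⟩
    rw [h0, norm_zero] at h'
    nlinarith
end

section
/- For every j ∈ {1,2,3,4} and every z ∈ ℂ, |a_{Lj}(λ,z)| ≤ e^{A·|Re(z)|}. -/
open MeasureTheory Set Filter

lemma aux_tail {E : Type*} [NormedAddCommGroup E] [NormedSpace ℝ E] [CompleteSpace E]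
    (f : ℝ → E) (hf : Continuous f) (hi : Integrable f) :
    (∀ x, HasDerivAt (fun x => ∫ t in Ioi x, f t) (-f x) x) ∧
    Tendsto (fun x => ∫ t in Ioi x, f t) atTop (nhds 0) ∧
    Tendsto (fun x => ∫ t in Ioi x, f t) atBot (nhds (∫ t, f t)) := by
  refine ⟨fun x => ?_, tendsto_integral_Ioi_zero tendsto_id, ?_⟩
  · have h : (fun x => ∫ t in Ioi x, f t) = fun x => (∫ t in Ioi (0:ℝ), f t) - ∫ t in (0:ℝ)..x, f t := by
      funext x
      rw [← intervalIntegral.integral_interval_add_Ioi (a := 0) (b := x) hi.integrableOn hi.integrableOn]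
      abel
    rw [h]
    exact (hf.integral_hasStrictDerivAt 0 x).hasDerivAt.const_sub _
  · exact (aecover_Ioi tendsto_id).integral_tendsto_of_countably_generated hi

lemma aux_int (a : ℝ → ℝ) (ha : Integrable a) (v g : ℝ → ℂ) (hv : Continuous v)
    (hva : ∀ x, ‖v x‖ = a x) (hg : Continuous g) (K : ℝ) (hK : ∀ x, ‖g x‖ ≤ K) :
    Integrable (fun x => v x * g x) := by
  refine (ha.mul_const K).mono' (hv.mul hg).aestronglyMeasurable (ae_of_all _ fun x => ?_)
  rw [norm_mul, hva]
  have : 0 ≤ a x := hva x ▸ norm_nonneg _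
  gcongr
  exact hK x

lemma aux_core (a : ℝ → ℝ) (hac : Continuous a) (ha : Integrable a) (u P Q : ℝ → ℂ) (z : ℂ)
    (hu : Continuous u) (hua : ∀ x, ‖u x‖ = a x) (hPc : Continuous P) (hQc : Continuous Q)
    (K L : ℝ) (hPK : ∀ x, ‖P x‖ ≤ K) (hQL : ∀ x, ‖Q x‖ ≤ L)
    (hP : ∀ x, P x = 1 - Complex.I * z * ∫ t in Ioi x, u t * Q t)
    (hQ : ∀ x, Q x = Complex.I * z * ∫ t in Ioi x, (starRingEnd ℂ) (u t) * P t) :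
    ‖1 - Complex.I * z * ∫ t, u t * Q t‖ ≤ Real.exp ((∫ x : ℝ, a x) * |z.re|) ∧
    ‖Complex.I * z * ∫ t, (starRingEnd ℂ) (u t) * P t‖ ≤ Real.exp ((∫ x : ℝ, a x) * |z.re|) := by
  have hcu : Continuous (fun t => (starRingEnd ℂ) (u t)) := Complex.continuous_conj.comp hu
  have i1 := aux_int a ha u Q hu hua hQc L hQL
  have i2 := aux_int a ha (fun t => (starRingEnd ℂ) (u t)) P hcu
    (fun x => by rw [RCLike.norm_conj, hua]) hPc K hPK
  obtain ⟨d1, t1, b1⟩ := aux_tail (fun t => u t * Q t) (hu.mul hQc) i1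
  obtain ⟨d2, t2, b2⟩ := aux_tail (fun t => (starRingEnd ℂ) (u t) * P t) (hcu.mul hPc) i2
  obtain ⟨d3, t3, b3⟩ := aux_tail a hac ha
  have eP : P = fun x => 1 - Complex.I * z * ∫ t in Ioi x, u t * Q t := funext hP
  have eQ : Q = fun x => Complex.I * z * ∫ t in Ioi x, (starRingEnd ℂ) (u t) * P t := funext hQ
  have dP : ∀ x, HasDerivAt P (Complex.I * z * (u x * Q x)) x := by
    intro x
    have h := ((d1 x).const_mul (Complex.I * z)).const_sub 1
    rw [← eP] at h
    convert! h using 1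
    ring
  have dQ : ∀ x, HasDerivAt Q (-(Complex.I * z * ((starRingEnd ℂ) (u x) * P x))) x := by
    intro x
    have h := ((d2 x).const_mul (Complex.I * z))
    rw [← eQ] at h
    convert! h using 1
    ring
  have tP : Tendsto P atTop (nhds 1) := by
    have h := (t1.const_mul (Complex.I * z)).const_sub 1
    rw [← eP] at h
    simpa using h
  have tQ : Tendsto Q atTop (nhds 0) := by
    have h := (t2.const_mul (Complex.I * z))
    rw [← eQ] at h
    simpa using h
  have bP : Tendsto P atBot (nhds (1 - Complex.I * z * ∫ t, u t * Q t)) := by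
    have h := (b1.const_mul (Complex.I * z)).const_sub 1
    rwa [← eP] at h
  have bQ : Tendsto Q atBot (nhds (Complex.I * z * ∫ t, (starRingEnd ℂ) (u t) * P t)) := by
    have h := (b2.const_mul (Complex.I * z))
    rwa [← eQ] at h
  set B : ℝ → ℝ := fun x => ∫ t in Ioi x, a t with hB
  set p := 1 - Complex.I * z * ∫ t, u t * Q t
  set r := Complex.I * z * ∫ t, (starRingEnd ℂ) (u t) * P t
  set G : ℝ → ℝ := fun x => (‖P x‖ ^ 2 + ‖Q x‖ ^ 2) * Real.exp (-(2 * |z.re|) * B x) with hG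
  have dG : ∀ x, HasDerivAt G _ x := fun x =>
    ((dP x).norm_sq.add (dQ x).norm_sq).mul (((d3 x).const_mul (-(2 * |z.re|))).exp)
  have mono : Monotone G := by
    refine monotone_of_deriv_nonneg (fun x => (dG x).differentiableAt) (fun x => ?_)
    rw [(dG x).deriv]
    simp only [Pi.add_apply]
    have key : 2 * inner ℝ (P x) (Complex.I * z * (u x * Q x)) +
        2 * inner ℝ (Q x) (-(Complex.I * z * ((starRingEnd ℂ) (u x) * P x)))
        = -(4 * z.re * (u x * Q x * (starRingEnd ℂ) (P x)).im) := by
      simp [Complex.inner]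
      ring
    rw [key]
    have hw : |(u x * Q x * (starRingEnd ℂ) (P x)).im| ≤ a x * ‖Q x‖ * ‖P x‖ := by
      refine (Complex.abs_im_le_norm _).trans ?_
      rw [norm_mul, norm_mul, RCLike.norm_conj, hua]
    set w := (u x * Q x * (starRingEnd ℂ) (P x)).im
    have ha0 : 0 ≤ a x := hua x ▸ norm_nonneg _
    have h1 : z.re * w ≤ |z.re| * (a x * ‖Q x‖ * ‖P x‖) := by
      refine (le_abs_self _).trans ?_
      rw [abs_mul]
      gcongr
    have h2 : 0 ≤ |z.re| * a x * (‖P x‖ - ‖Q x‖) ^ 2 := by positivity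
    have h3 : 0 ≤ -(4 * z.re * w) + (‖P x‖ ^ 2 + ‖Q x‖ ^ 2) * (2 * |z.re| * a x) := by
      nlinarith
    have h4 := mul_nonneg h3 (Real.exp_pos (-(2 * |z.re|) * B x)).le
    convert! h4 using 1
    simp only [hB]
    ring
  have tG : Tendsto G atTop (nhds 1) := by
    have h := ((tP.norm.pow 2).add (tQ.norm.pow 2)).mul
      ((Real.continuous_exp.tendsto _).comp (t3.const_mul (-(2 * |z.re|))))
    have e : nhds (1:ℝ) = nhds ((‖(1:ℂ)‖ ^ 2 + ‖(0:ℂ)‖ ^ 2) * Real.exp (-(2 * |z.re|) * 0)) := by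
      simp
    rw [e]
    exact h
  have bG : Tendsto G atBot (nhds ((‖p‖ ^ 2 + ‖r‖ ^ 2) *
      Real.exp (-(2 * |z.re|) * ∫ x, a x))) :=
    ((bP.norm.pow 2).add (bQ.norm.pow 2)).mul
      ((Real.continuous_exp.tendsto _).comp (b3.const_mul (-(2 * |z.re|))))
  have hle : (‖p‖ ^ 2 + ‖r‖ ^ 2) * Real.exp (-(2 * |z.re|) * ∫ x, a x) ≤ 1 :=
    le_of_tendsto bG (Eventually.of_forall fun x => mono.ge_of_tendsto tG x)
  have hle2 : ‖p‖ ^ 2 + ‖r‖ ^ 2 ≤ Real.exp ((∫ x : ℝ, a x) * |z.re|) ^ 2 := by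
    have he : Real.exp (-(2 * |z.re|) * ∫ x, a x) = (Real.exp ((∫ x : ℝ, a x) * |z.re|) ^ 2)⁻¹ := by
      rw [← Real.exp_nat_mul, ← Real.exp_neg]
      congr 1
      push_cast
      ring
    rw [he, ← div_eq_mul_inv, div_le_one (by positivity)] at hle
    exact hle
  constructor
  · refine le_of_sq_le_sq ?_ (Real.exp_pos _).le
    nlinarith [sq_nonneg ‖r‖]
  · refine le_of_sq_le_sq ?_ (Real.exp_pos _).le
    nlinarith [sq_nonneg ‖p‖]

lemma aux_step (a : ℝ → ℝ) (hac : Continuous a) (ha : Integrable a) (ha0 : ∀ x, 0 ≤ a x)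
    (v g : ℝ → ℂ) (hv : Continuous v)
    (hva : ∀ x, ‖v x‖ = a x) (hg : Continuous g) (k : ℕ)
    (hK : ∀ x, ‖g x‖ ≤ (∫ t in Ioi x, a t) ^ k / k.factorial) :
    Continuous (fun x => ∫ t in Ioi x, v t * g t) ∧
    ∀ x, ‖∫ t in Ioi x, v t * g t‖ ≤ (∫ t in Ioi x, a t) ^ (k+1) / (k+1).factorial := by
  obtain ⟨d3, t3, b3⟩ := aux_tail a hac ha
  have hBA : ∀ x, ‖g x‖ ≤ (∫ t, a t) ^ k / k.factorial := by
    intro x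
    refine (hK x).trans ?_
    have : 0 ≤ ∫ t in Ioi x, a t := integral_nonneg ha0
    exact div_le_div_of_nonneg_right (pow_le_pow_left₀ this
      (setIntegral_le_integral ha (ae_of_all _ ha0)) k) (by positivity)
  have i1 := aux_int a ha v g hv hva hg _ hBA
  obtain ⟨d1, t1, b1⟩ := aux_tail (fun t => v t * g t) (hv.mul hg) i1
  refine ⟨continuous_iff_continuousAt.2 fun x => (d1 x).continuousAt, fun x => ?_⟩
  set B : ℝ → ℝ := fun x => ∫ t in Ioi x, a t with hB
  have hB0 : ∀ x, 0 ≤ B x := fun x => integral_nonneg ha0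
  have dB : ∀ y ∈ Ici x, HasDerivAt (fun y => B y ^ (k+1) / (k+1).factorial)
      (-(a y * (B y ^ k / k.factorial))) y := by
    intro y _
    convert! ((d3 y).pow (k+1)).div_const ((k+1).factorial : ℝ) using 1
    rw [Nat.factorial_succ]
    push_cast
    simp only [hB]
    field_simp
  have tB : Tendsto (fun y => B y ^ (k+1) / (k+1).factorial) atTop (nhds 0) := by
    simpa using (t3.pow (k+1)).div_const ((k+1).factorial : ℝ)
  have hneg : ∀ y ∈ Ioi x, -(a y * (B y ^ k / k.factorial)) ≤ 0 := by
    intro y _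
    have := hB0 y
    have := ha0 y
    simp only [Left.neg_nonpos_iff]
    positivity
  have hi := integrableOn_Ioi_deriv_of_nonpos' dB hneg tB
  have hint := integral_Ioi_of_hasDerivAt_of_tendsto' dB hi tB
  rw [integral_neg] at hint
  have hi' : IntegrableOn (fun y => a y * (B y ^ k / k.factorial)) (Ioi x) := by
    simpa using hi.neg
  have h := norm_integral_le_of_norm_le (f := fun t => v t * g t) hi'
    (ae_of_all _ fun y => by
      rw [norm_mul, hva]
      exact mul_le_mul_of_nonneg_left (hK y) (ha0 y))
  refine h.trans ?_
  show _ ≤ B x ^ (k+1) / _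
  linarith

lemma aux_swap (a : ℝ → ℝ) (ha : Integrable a) (ha0 : ∀ x, 0 ≤ a x)
    (v : ℝ → ℂ) (g : ℕ → ℝ → ℂ) (hv : Continuous v)
    (hva : ∀ x, ‖v x‖ = a x) (hg : ∀ n, Continuous (g n)) (K : ℕ → ℝ)
    (hK : ∀ n x, ‖g n x‖ ≤ K n) (hs : Summable K) (x : ℝ) :
    ∫ t in Ioi x, v t * ∑' n, g n t = ∑' n, ∫ t in Ioi x, v t * g n t := by
  have hi : ∀ n, Integrable (fun t => v t * g n t) := fun n =>
    aux_int a ha v (g n) hv hva (hg n) _ (hK n)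
  have h := hasSum_integral_of_summable_integral_norm (μ := volume.restrict (Ioi x))
    (F := fun n t => v t * g n t) (fun n => (hi n).integrableOn) (by
      refine Summable.of_nonneg_of_le (fun n => integral_nonneg fun t => norm_nonneg _) (fun n => ?_)
        (hs.mul_left (∫ t in Ioi x, a t))
      rw [← integral_mul_const]
      refine integral_mono (hi n).norm.integrableOn (ha.mul_const _).integrableOn fun t => ?_
      show ‖v t * g n t‖ ≤ a t * K n
      rw [norm_mul, hva]
      exact mul_le_mul_of_nonneg_left (hK n t) (ha0 t))
  rw [h.tsum_eq]
  simp only [tsum_mul_left]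

lemma aux_alg (q : ℝ → ℂ) (lam : ℝ) (n : ℕ) :
    (∀ x : ℝ, Complex.exp (2 * Complex.I * lam * x) * mL3 q lam n x =
      Complex.I * ∫ t in Ioi x,
        (starRingEnd ℂ) (Complex.exp (-(2 * Complex.I * lam * t)) * q t) * mL1 q lam n t) ∧
    (∀ x : ℝ, mL1 q lam (n+1) x = -Complex.I * ∫ t in Ioi x,
      (Complex.exp (-(2 * Complex.I * lam * t)) * q t) *
        (Complex.exp (2 * Complex.I * lam * t) * mL3 q lam n t)) := by
  have hconj : ∀ t : ℝ, (starRingEnd ℂ) (Complex.exp (-(2 * Complex.I * lam * t)) * q t)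
      = Complex.exp (2 * Complex.I * lam * t) * (starRingEnd ℂ) (q t) := by
    intro t
    rw [map_mul, ← Complex.exp_conj]
    simp [map_ofNat]
  have hcan : ∀ t : ℝ, Complex.exp (-(2 * Complex.I * lam * t)) *
      Complex.exp (2 * Complex.I * lam * t) = 1 := by
    intro t
    rw [← Complex.exp_add]
    simp
  have hsub : ∀ t y : ℝ, Complex.exp (2 * Complex.I * lam * ((t : ℂ) - y)) =
      Complex.exp (2 * Complex.I * lam * t) * Complex.exp (-(2 * Complex.I * lam * y)) := by
    intro t y
    rw [← Complex.exp_add]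
    ring_nf
  -- the second identity follows from the first one
  have step : ∀ n, (∀ x : ℝ, Complex.exp (2 * Complex.I * lam * x) * mL3 q lam n x =
      Complex.I * ∫ t in Ioi x,
        (starRingEnd ℂ) (Complex.exp (-(2 * Complex.I * lam * t)) * q t) * mL1 q lam n t) →
    (∀ x : ℝ, mL1 q lam (n+1) x = -Complex.I * ∫ t in Ioi x,
      (Complex.exp (-(2 * Complex.I * lam * t)) * q t) *
        (Complex.exp (2 * Complex.I * lam * t) * mL3 q lam n t)) := by
    intro n h x
    rw [mL1, ← integral_const_mul]
    congr 1
    funext y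
    rw [h y, ← integral_const_mul, ← integral_const_mul, ← integral_const_mul]
    congr 1
    funext t
    rw [hconj, hsub]
    linear_combination (Complex.exp (2 * Complex.I * lam * t) * Complex.exp (-(2 * Complex.I * lam * y)) * q y * (starRingEnd ℂ) (q t) * mL1 q lam n t) * Complex.I_sq
  induction n with
  | zero =>
    refine ⟨?_, step 0 ?_⟩ <;>
    · intro x
      rw [mL3, ← integral_const_mul, ← integral_const_mul, ← integral_const_mul]
      congr 1
      funext t
      rw [hconj, hsub, mL1]
      linear_combination (Complex.I * Complex.exp (2 * Complex.I * lam * t) * (starRingEnd ℂ) (q t)) * hcan x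
  | succ n ih =>
    have h1 : ∀ x : ℝ, Complex.exp (2 * Complex.I * lam * x) * mL3 q lam (n+1) x =
      Complex.I * ∫ t in Ioi x,
        (starRingEnd ℂ) (Complex.exp (-(2 * Complex.I * lam * t)) * q t) * mL1 q lam (n+1) t := by
      intro x
      rw [mL3, ← integral_const_mul, ← integral_const_mul]
      congr 1
      funext y
      rw [ih.2 y, ← integral_const_mul, ← integral_const_mul, ← integral_const_mul,
        ← integral_const_mul]
      congr 1
      funext t
      rw [hconj, hsub]
      have e1 := hcan x
      have e2 := hcan t
      set X := Complex.exp (2 * Complex.I * lam * x)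
      set X' := Complex.exp (-(2 * Complex.I * lam * x))
      set T := Complex.exp (2 * Complex.I * lam * t)
      set T' := Complex.exp (-(2 * Complex.I * lam * t))
      set Y := Complex.exp (2 * Complex.I * lam * y)
      linear_combination (Y * (starRingEnd ℂ) (q y) * q t * mL3 q lam n t) * e1
        - (Y * (starRingEnd ℂ) (q y) * q t * mL3 q lam n t) * e2
        + (Y * (starRingEnd ℂ) (q y) * q t * mL3 q lam n t * T' * T) * Complex.I_sq
    exact ⟨h1, step _ h1⟩

lemma aux_main
    (a : ℝ → ℝ) (q : ℝ → ℂ) (lam : ℝ)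
    (ha_cont : Continuous a) (ha0 : ∀ x, 0 ≤ a x) (ha : Integrable a)
    (hq_cont : Continuous q) (hq_abs : ∀ x, ‖q x‖ = a x) (z : ℂ) :
    ‖aL1 q lam z‖ ≤ Real.exp ((∫ x : ℝ, a x) * |z.re|) ∧
    ‖aL3 q lam z‖ ≤ Real.exp ((∫ x : ℝ, a x) * |z.re|) := by
  obtain ⟨u, hu⟩ : ∃ u : ℝ → ℂ, u = fun t : ℝ => Complex.exp (-(2 * Complex.I * lam * t)) * q t := ⟨_, rfl⟩
  obtain ⟨s, hs⟩ : ∃ s : ℕ → ℝ → ℂ,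
    s = fun (n : ℕ) (x : ℝ) => Complex.exp (2 * Complex.I * lam * x) * mL3 q lam n x := ⟨_, rfl⟩
  obtain ⟨p, hp⟩ : ∃ p : ℕ → ℝ → ℂ, p = mL1 q lam := ⟨_, rfl⟩
  have hexp : ∀ t : ℝ, ‖Complex.exp (-(2 * Complex.I * lam * t))‖ = 1 := by
    intro t
    rw [Complex.norm_exp]
    simp
  have huc : Continuous u := by rw [hu]; fun_prop
  have hua : ∀ x, ‖u x‖ = a x := by
    intro x
    rw [hu]
    simp only [norm_mul, hexp, hq_abs, one_mul]
  have hcc : Continuous (fun t => (starRingEnd ℂ) (u t)) := Complex.continuous_conj.comp huc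
  have hca : ∀ x, ‖(starRingEnd ℂ) (u x)‖ = a x := fun x => by rw [RCLike.norm_conj, hua]
  have hsp : ∀ n x, s n x = Complex.I * ∫ t in Ioi x, (starRingEnd ℂ) (u t) * p n t := by
    intro n x
    rw [hs, hp, hu]
    exact (aux_alg q lam n).1 x
  have hps : ∀ n x, p (n+1) x = -Complex.I * ∫ t in Ioi x, u t * s n t := by
    intro n x
    rw [hs, hp, hu]
    exact (aux_alg q lam n).2 x
  have hp0 : ∀ x, p 0 x = 1 := by intro x; rw [hp, mL1]
  have stepS : ∀ n, (Continuous (p n) ∧ ∀ x, ‖p n x‖ ≤ (∫ t in Ioi x, a t) ^ (2*n) / (2*n).factorial)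
      → (Continuous (s n) ∧ ∀ x, ‖s n x‖ ≤ (∫ t in Ioi x, a t) ^ (2*n+1) / (2*n+1).factorial) := by
    intro n h
    have h2 := aux_step a ha_cont ha ha0 _ (p n) hcc hca h.1 (2*n) h.2
    refine ⟨?_, fun x => ?_⟩
    · rw [show s n = _ from funext (hsp n)]
      exact continuous_const.mul h2.1
    · rw [hsp, norm_mul, Complex.norm_I, one_mul]
      exact h2.2 x
  have bdP : ∀ n, (Continuous (p n) ∧ ∀ x, ‖p n x‖ ≤ (∫ t in Ioi x, a t) ^ (2*n) / (2*n).factorial) := by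
    intro n
    induction n with
    | zero =>
      refine ⟨?_, fun x => ?_⟩
      · rw [show p 0 = _ from funext hp0]
        exact continuous_const
      · rw [hp0]; simp
    | succ n ih =>
      have h := stepS n ih
      have h2 := aux_step a ha_cont ha ha0 u (s n) huc hua h.1 (2*n+1) h.2
      refine ⟨?_, fun x => ?_⟩
      · rw [show p (n+1) = _ from funext (hps n)]
        exact continuous_const.mul h2.1
      · rw [hps, norm_mul, norm_neg, Complex.norm_I, one_mul]
        exact h2.2 x
  have bdS := fun n => stepS n (bdP n)
  set A := ∫ t, a t with hA
  have hB0 : ∀ x, 0 ≤ ∫ t in Ioi x, a t := fun x => integral_nonneg ha0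
  have hBA : ∀ x, ∫ t in Ioi x, a t ≤ A := fun x => setIntegral_le_integral ha (ae_of_all _ ha0)
  have sumE := Real.summable_pow_div_factorial (A * ‖z‖)
  have sumP : Summable (fun n : ℕ => (A * ‖z‖) ^ (2*n) / (2*n).factorial) :=
    sumE.comp_injective (i := fun n : ℕ => 2 * n) (fun m n h => by simpa using h)
  have sumS : Summable (fun n : ℕ => (A * ‖z‖) ^ (2*n+1) / (2*n+1).factorial) :=
    sumE.comp_injective (i := fun n : ℕ => 2 * n + 1) (fun m n h => by simpa using h)
  have boundP : ∀ n x, ‖p n x * z ^ (2*n)‖ ≤ (A * ‖z‖) ^ (2*n) / (2*n).factorial := by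
    intro n x
    rw [norm_mul, norm_pow, mul_pow, mul_div_right_comm]
    have := hB0 x
    gcongr
    refine ((bdP n).2 x).trans ?_
    gcongr
    exact hBA x
  have boundS : ∀ n x, ‖s n x * z ^ (2*n+1)‖ ≤ (A * ‖z‖) ^ (2*n+1) / (2*n+1).factorial := by
    intro n x
    rw [norm_mul, norm_pow, mul_pow, mul_div_right_comm]
    have := hB0 x
    gcongr
    refine ((bdS n).2 x).trans ?_
    gcongr
    exact hBA x
  have contP : ∀ n, Continuous (fun x => p n x * z ^ (2*n)) := fun n => (bdP n).1.mul continuous_const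
  have contS : ∀ n, Continuous (fun x => s n x * z ^ (2*n+1)) := fun n => (bdS n).1.mul continuous_const
  obtain ⟨P, hPd⟩ : ∃ P : ℝ → ℂ, P = fun x => ∑' n, p n x * z ^ (2*n) := ⟨_, rfl⟩
  obtain ⟨Q, hQd⟩ : ∃ Q : ℝ → ℂ, Q = fun x => ∑' n, s n x * z ^ (2*n+1) := ⟨_, rfl⟩
  have res := aux_core a ha_cont ha u P Q z huc hua
    (hPd ▸ continuous_tsum contP sumP boundP) (hQd ▸ continuous_tsum contS sumS boundS)
    _ _ (fun x => by rw [hPd]; exact tsum_of_norm_bounded sumP.hasSum (fun n => boundP n x))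
    (fun x => by rw [hQd]; exact tsum_of_norm_bounded sumS.hasSum (fun n => boundS n x))
    (fun x => by
      rw [hQd, aux_swap a ha ha0 u _ huc hua contS _ boundS sumS x, hPd]
      have hsm : Summable (fun n => p n x * z ^ (2*n)) :=
        Summable.of_norm_bounded sumP (fun n => boundP n x)
      simp only []
      rw [hsm.tsum_eq_zero_add, hp0, ← tsum_mul_left, sub_eq_add_neg, ← tsum_neg]
      congr 1
      · simp
      · congr 1
        funext n
        rw [hps]
        simp only [← mul_assoc, integral_mul_const]
        ring)
    (fun x => by
      rw [hPd, aux_swap a ha ha0 _ _ hcc hca contP _ boundP sumP x, hQd, ← tsum_mul_left]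
      simp only []
      congr 1
      funext n
      rw [hsp]
      simp only [← mul_assoc, integral_mul_const]
      ring)
  have hcan : ∀ t : ℝ, Complex.exp (-(2 * Complex.I * lam * t)) *
      Complex.exp (2 * Complex.I * lam * t) = 1 := by
    intro t
    rw [← Complex.exp_add]
    simp
  have e1 : aL1 q lam z = 1 - Complex.I * z * ∫ t, u t * Q t := by
    rw [aL1]
    congr 3
    funext x
    have : Q x = Complex.exp (2 * Complex.I * lam * x) * ML3 q lam x z := by
      rw [hQd, hs, ML3, ← tsum_mul_left]
      simp only [mul_assoc]
    rw [this, hu]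
    linear_combination (-q x * ML3 q lam x z) * hcan x
  have e3 : aL3 q lam z = Complex.I * z * ∫ t, (starRingEnd ℂ) (u t) * P t := by
    rw [aL3]
    congr 2
    funext x
    rw [hPd, hp, hu, ML1]
    congr 1
    simp only [map_mul, ← Complex.exp_conj]
    simp [map_ofNat]
  rw [e1, e3]
  exact res

lemma aux_m4 (q : ℝ → ℂ) (lam : ℝ) (n : ℕ) :
    mL1 (fun t => (starRingEnd ℂ) (q t)) (-lam) n = mL4 q lam n := by
  induction n with
  | zero => funext x; rw [mL1, mL4]
  | succ n ih =>
    funext x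
    rw [mL1, mL4, ih]
    simp

lemma aux_m2 (q : ℝ → ℂ) (lam : ℝ) (n : ℕ) :
    mL3 (fun t => (starRingEnd ℂ) (q t)) (-lam) n = fun x => -mL2 q lam n x := by
  induction n with
  | zero => funext x; rw [mL3, mL2]; simp
  | succ n ih =>
    funext x
    rw [mL3, mL2, ih]
    simp [integral_neg]

theorem stmt6
    (a : ℝ → ℝ) (q : ℝ → ℂ) (lam : ℝ)
    (ha_cont : Continuous a) (ha_nonneg : ∀ x, 0 ≤ a x) (ha_int : Integrable a)
    (hq_cont : Continuous q) (hq_abs : ∀ x, ‖q x‖ = a x) :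
    ∀ z : ℂ,
      ‖aL1 q lam z‖ ≤ Real.exp ((∫ x : ℝ, a x) * |z.re|) ∧
      ‖aL2 q lam z‖ ≤ Real.exp ((∫ x : ℝ, a x) * |z.re|) ∧
      ‖aL3 q lam z‖ ≤ Real.exp ((∫ x : ℝ, a x) * |z.re|) ∧
      ‖aL4 q lam z‖ ≤ Real.exp ((∫ x : ℝ, a x) * |z.re|) := by
  intro z
  obtain ⟨h1, h3⟩ := aux_main a q lam ha_cont ha_nonneg ha_int hq_cont hq_abs z
  obtain ⟨h4, h2⟩ := aux_main a (fun t => (starRingEnd ℂ) (q t)) (-lam) ha_cont ha_nonneg ha_int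
    (Complex.continuous_conj.comp hq_cont) (fun x => by rw [RCLike.norm_conj, hq_abs]) (-z)
  have e4 : aL1 (fun t => (starRingEnd ℂ) (q t)) (-lam) (-z) = aL4 q lam z := by
    have hM : ∀ x, ML3 (fun t => (starRingEnd ℂ) (q t)) (-lam) x (-z) = ML2 q lam x z := by
      intro x
      rw [ML3, ML2]
      congr 1
      funext n
      rw [aux_m2, Odd.neg_pow ⟨n, rfl⟩]
      ring
    rw [aL1, aL4]
    simp only [hM]
    ring
  have e2 : aL3 (fun t => (starRingEnd ℂ) (q t)) (-lam) (-z) = aL2 q lam z := by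
    have hM : ∀ x, ML1 (fun t => (starRingEnd ℂ) (q t)) (-lam) x (-z) = ML4 q lam x z := by
      intro x
      rw [ML1, ML4]
      congr 1
      funext n
      rw [aux_m4, Even.neg_pow ⟨n, by ring⟩]
    rw [aL3, aL2]
    simp [hM]
  rw [e4, Complex.neg_re, abs_neg] at h4
  rw [e2, Complex.neg_re, abs_neg] at h2
  exact ⟨h1, h2, h3, h4⟩
end

section
/- Let A ≥ 0 and C ≥ 0, and let h be holomorphic on the right half-plane Π⁺ = {z ∈ ℂ : Re(z) > 0} with |h(z)| ≤ C·e^{A·Re(z)} for all z ∈ Π⁺. Then sup_{0<r<1} ∫_{−π}^{π} ln⁺|h((1 − r e^{iθ})/(1 + r e^{iθ}))| dθ < ∞; that is, h belongs to the Nevanlinna class N(Π⁺). -/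
open MeasureTheory Set Filter

theorem aux_re_pos (w : ℂ) (hw : ‖w‖ < 1) : 0 < ((1 - w) / (1 + w)).re := by
  have h1 : (1 + w) ≠ 0 := by
    intro h0
    have : w = -1 := by linear_combination h0
    rw [this] at hw
    simp at hw
  have h2 : 0 < Complex.normSq (1 + w) := Complex.normSq_pos.mpr h1
  have h3 : Complex.normSq w < 1 := by
    rw [Complex.normSq_eq_norm_sq]
    nlinarith [norm_nonneg w]
  rw [Complex.div_re, ← add_div]
  apply div_pos _ h2
  rw [Complex.normSq_apply] at h3
  simp
  nlinarith

theorem aux_ne (w : ℂ) (hw : ‖w‖ < 1) : 1 + w ≠ 0 := by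
  intro h0
  have := aux_re_pos w hw
  rw [h0] at this
  simp at this

theorem aux_int_s7 (r : ℝ) (h0 : 0 < r) (h1 : r < 1) :
    (∫ θ in (-Real.pi)..Real.pi,
      (1 - circleMap 0 r θ) / (1 + circleMap 0 r θ)) = 2 * Real.pi := by
  have hd : DiffContOnCl ℂ (fun w : ℂ => (1 - w) / (1 + w)) (Metric.ball 0 |r|) := by
    apply DifferentiableOn.diffContOnCl
    intro w hw
    have hw' : ‖w‖ < 1 := by
      have := Metric.closure_ball_subset_closedBall hw
      rw [mem_closedBall_zero_iff, abs_of_pos h0] at this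
      linarith
    have := aux_ne w hw'
    exact DifferentiableAt.differentiableWithinAt (by fun_prop (disch := assumption))
  have h2 := hd.circleAverage
  rw [Real.circleAverage_def] at h2
  have hp : Function.Periodic (fun θ : ℝ => (1 - circleMap 0 r θ) / (1 + circleMap 0 r θ))
      (2 * Real.pi) := by
    intro θ
    simp only [periodic_circleMap 0 r θ]
  have h3 := hp.intervalIntegral_add_eq (-Real.pi) 0
  rw [show -Real.pi + 2 * Real.pi = Real.pi by ring, zero_add] at h3
  rw [h3]
  have hpi : (Real.pi : ℂ) ≠ 0 := by exact_mod_cast Real.pi_ne_zero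
  simp only [Complex.real_smul, sub_zero, add_zero, div_one] at h2
  push_cast at h2
  field_simp at h2
  rw [h2]

theorem stmt7 (A C : ℝ) (hA : 0 ≤ A) (hC : 0 ≤ C) (h : ℂ → ℂ)
    (hhol : DifferentiableOn ℂ h {z : ℂ | 0 < z.re})
    (hbd : ∀ z : ℂ, 0 < z.re → ‖h z‖ ≤ C * Real.exp (A * z.re)) :
    ∃ B : ℝ, ∀ r : ℝ, 0 < r → r < 1 →
      (∫ θ in (-Real.pi)..Real.pi,
        max (Real.log ‖h ((1 - (r : ℂ) * Complex.exp (Complex.I * (θ : ℂ))) /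
          (1 + (r : ℂ) * Complex.exp (Complex.I * (θ : ℂ))))‖) 0) ≤ B := by
  refine ⟨2 * Real.pi * (|Real.log C| + A), fun r h0 h1 => ?_⟩
  have hn : ∀ θ, ‖circleMap 0 r θ‖ < 1 := by
    intro θ
    rw [norm_circleMap_zero, abs_of_pos h0]; exact h1
  have hc : Continuous (fun θ : ℝ => (1 - circleMap 0 r θ) / (1 + circleMap 0 r θ)) := by
    apply Continuous.div
    · exact continuous_const.sub (continuous_circleMap 0 r)
    · exact continuous_const.add (continuous_circleMap 0 r)
    · exact fun θ => aux_ne _ (hn θ)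
  have hcr := Complex.continuous_re.comp hc
  have hI : (∫ θ in (-Real.pi)..Real.pi,
      ((1 - circleMap 0 r θ) / (1 + circleMap 0 r θ)).re) = 2 * Real.pi := by
    have h2 := Complex.reCLM.intervalIntegral_comp_comm
      (hc.intervalIntegrable (μ := volume) (-Real.pi) Real.pi)
    rw [aux_int_s7 r h0 h1] at h2
    simpa using h2
  have hle : -Real.pi ≤ Real.pi := by linarith [Real.pi_pos]
  have key := intervalIntegral.norm_integral_le_of_norm_le (μ := volume) hle
    (f := fun θ : ℝ => max (Real.log ‖h ((1 - (r : ℂ) * Complex.exp (Complex.I * (θ : ℂ))) /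
          (1 + (r : ℂ) * Complex.exp (Complex.I * (θ : ℂ))))‖) 0)
    (g := fun θ : ℝ => |Real.log C| +
      A * ((1 - circleMap 0 r θ) / (1 + circleMap 0 r θ)).re)
    (Eventually.of_forall fun θ _ => ?_)
    ((continuous_const.add (continuous_const.mul hcr)).intervalIntegrable _ _)
  · refine (le_abs_self _).trans (key.trans (le_of_eq ?_))
    have hci : IntervalIntegrable (fun θ : ℝ =>
        A * ((1 - circleMap 0 r θ) / (1 + circleMap 0 r θ)).re) volume (-Real.pi) Real.pi :=
      (continuous_const.mul hcr).intervalIntegrable _ _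
    rw [intervalIntegral.integral_add (continuous_const.intervalIntegrable _ _) hci,
      intervalIntegral.integral_const_mul, hI, intervalIntegral.integral_const, smul_eq_mul]
    ring
  · have e : (r : ℂ) * Complex.exp (Complex.I * (θ : ℂ)) = circleMap 0 r θ := by
      simp [circleMap, mul_comm]
    rw [e]
    have hp := aux_re_pos _ (hn θ)
    generalize (1 - circleMap 0 r θ) / (1 + circleMap 0 r θ) = z at hp ⊢
    rw [Real.norm_of_nonneg (le_max_right _ _)]
    have hr : 0 ≤ |Real.log C| + A * z.re := by positivity
    refine max_le ?_ hr
    rcases eq_or_ne (h z) 0 with hz | hz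
    · simpa [hz] using hr
    · have hb := hbd z hp
      have hz' : 0 < ‖h z‖ := norm_pos_iff.mpr hz
      have hC' : C ≠ 0 := by
        rintro rfl
        simp at hb
        exact hz hb
      have := Real.log_le_log hz' hb
      rw [Real.log_mul hC' (Real.exp_ne_zero _), Real.log_exp] at this
      linarith [le_abs_self (Real.log C)]
end

section
/- Let h be holomorphic on Π⁺ and belong to the Nevanlinna class N(Π⁺). Suppose there exist a constant C₂ > 0, a strictly increasing sequence (α_l)_{l≥1} of positive real numbers with α_l ≤ C₂·l for all l ≥ 1, and a subset 𝔏 of the positive integers with Σ_{l∈𝔏} 1/l = ∞, such that h(α_l) = 0 for every l ∈ 𝔏. Then h is identically zero on Π⁺. -/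
open MeasureTheory Set Filter

lemma aux_disc_zeros (f : ℂ → ℂ) (hf : AnalyticOnNhd ℂ f (Metric.ball 0 1))
    (hne : ∀ u ∈ Metric.ball (0 : ℂ) 1, meromorphicOrderAt f u ≠ ⊤)
    (B : ℝ) (hB : ∀ r : ℝ, 0 < r → r < 1 →
      Real.circleAverage (fun z => Real.log ‖f z‖) 0 r ≤ B) :
    ∃ K : ℝ, ∀ S : Finset ℂ, (∀ u ∈ S, u ∈ Metric.ball (0 : ℂ) 1 ∧ u ≠ 0 ∧ f u = 0) →
      ∑ u ∈ S, (1 - ‖u‖) ≤ K := by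
  classical
  set d : ℝ := (((meromorphicOrderAt f 0).untop₀ : ℤ) : ℝ) with hd
  have hd0 : 0 ≤ d := by
    rw [hd]
    have := (hf 0 (by simp)).meromorphicOrderAt_nonneg
    exact_mod_cast (by simpa using this : 0 ≤ (meromorphicOrderAt f 0).untop₀)
  refine ⟨2 * (B + d * Real.log 2 - Real.log ‖meromorphicTrailingCoeffAt f 0‖), fun S hS => ?_⟩
  have hev : ∀ᶠ R in nhdsWithin (1 : ℝ) (Iio 1), R < 1 ∧ 1/2 < R ∧ ∀ u ∈ S, (1 + ‖u‖)/2 < R := by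
    refine (eventually_mem_nhdsWithin (a := (1:ℝ)) (s := Iio 1)).and (nhdsWithin_le_nhds ?_)
    refine (eventually_gt_nhds (by norm_num)).and ?_
    rw [Filter.eventually_all_finset]
    intro u hu
    have := (hS u hu).1
    rw [mem_ball_zero_iff] at this
    exact eventually_gt_nhds (by linarith)
  obtain ⟨R, hR1, hR2, hR3⟩ := hev.exists
  have hR0 : 0 < R := by linarith
  have hsub : Metric.closedBall (0 : ℂ) |R| ⊆ Metric.ball 0 1 := by
    rw [abs_of_pos hR0]; exact Metric.closedBall_subset_ball hR1
  have hfR := hf.mono hsub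
  have J := hfR.meromorphicOn.circleAverage_log_norm hR0.ne'
  set D := MeromorphicOn.divisor f (Metric.closedBall (0 : ℂ) |R|) with hD
  have hDfin := D.finiteSupport (isCompact_closedBall (0:ℂ) |R|)
  have hDnn : ∀ u, 0 ≤ D u := fun u => MeromorphicOn.AnalyticOnNhd.divisor_nonneg hfR u
  have hD0 : (D 0 : ℝ) = d := by
    rw [hD, MeromorphicOn.divisor_apply hfR.meromorphicOn (by simp)]
  have hterm : ∀ u, 0 ≤ (D u : ℝ) * Real.log (R * ‖(0:ℂ) - u‖⁻¹) := by
    intro u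
    by_cases hu : u ∈ Metric.closedBall (0 : ℂ) |R|
    · refine mul_nonneg (by exact_mod_cast hDnn u) ?_
      by_cases h0 : u = 0
      · simp [h0]
      · apply Real.log_nonneg
        have : 0 < ‖u‖ := norm_pos_iff.mpr h0
        rw [zero_sub, norm_neg, ← div_eq_mul_inv, le_div_iff₀ this, one_mul]
        simpa [abs_of_pos hR0] using hu
    · have : D u = 0 := by
        rw [hD, MeromorphicOn.divisor_def, if_neg (by tauto)]
      simp [this]
  have hSle : ∑ u ∈ S, (1 - ‖u‖) / 2 ≤ ∑ᶠ u, (D u : ℝ) * Real.log (R * ‖(0:ℂ) - u‖⁻¹) := by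
    have hfs : (Function.support fun u => (D u : ℝ) * Real.log (R * ‖(0:ℂ) - u‖⁻¹)) ⊆
        ↑(hDfin.toFinset ∪ S) := by
      intro x hx
      simp only [Function.mem_support] at hx
      simp only [Finset.coe_union, Set.Finite.coe_toFinset]
      left
      intro h0
      apply hx
      simp [h0]
    rw [finsum_eq_sum_of_support_subset _ hfs]
    refine le_trans (Finset.sum_le_sum (fun u hu => ?_))
      (Finset.sum_le_sum_of_subset_of_nonneg Finset.subset_union_right (fun u _ _ => hterm u))
    obtain ⟨hu1, hu0, hfu⟩ := hS u hu
    have hu3 := hR3 u hu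
    have hup : 0 < ‖u‖ := norm_pos_iff.mpr hu0
    have hul : ‖u‖ < 1 := by simpa using hu1
    have huR : u ∈ Metric.closedBall (0:ℂ) |R| := by
      rw [abs_of_pos hR0, mem_closedBall_zero_iff]; linarith
    have hD1 : 1 ≤ D u := by
      rw [hD, MeromorphicOn.divisor_apply hfR.meromorphicOn huR]
      have hA := hf u hu1
      have hpos : 0 < meromorphicOrderAt f u := by
        rw [← tendsto_zero_iff_meromorphicOrderAt_pos hA.meromorphicAt]
        have := hA.continuousAt.tendsto
        rw [hfu] at this
        exact this.mono_left nhdsWithin_le_nhds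
      have hn := hne u hu1
      lift meromorphicOrderAt f u to ℤ using hn with n
      have : 0 < n := by exact_mod_cast hpos
      have h1n : 1 ≤ n := this
      simpa using h1n
    have hlog : (1 - ‖u‖)/2 ≤ Real.log (R * ‖(0:ℂ) - u‖⁻¹) := by
      rw [zero_sub, norm_neg]
      have h1 := Real.one_sub_inv_le_log_of_pos (x := R * ‖u‖⁻¹) (by positivity)
      refine le_trans ?_ h1
      rw [mul_inv, inv_inv, inv_mul_eq_div]
      have : ‖u‖ / R ≤ ‖u‖ / ((1 + ‖u‖)/2) := by gcongr
      have h2 : ‖u‖ / ((1 + ‖u‖)/2) ≤ (1 + ‖u‖)/2 := by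
        rw [div_le_iff₀ (by positivity)]
        nlinarith [sq_nonneg (1 - ‖u‖)]
      linarith
    have hD1' : (1:ℝ) ≤ D u := by exact_mod_cast hD1
    nlinarith
  rw [← Finset.sum_div] at hSle
  have hJ := hB R hR0 hR1
  have hlogR : - Real.log 2 ≤ Real.log R := by
    rw [← Real.log_inv]
    apply Real.log_le_log (by norm_num); linarith
  rw [hD0] at J
  nlinarith

lemma aux_re (w : ℂ) (hw : ‖w‖ < 1) : 1 + w ≠ 0 ∧ 0 < ((1 - w) / (1 + w)).re := by
  have h1 : w.re ^ 2 + w.im ^ 2 < 1 := by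
    have := Complex.sq_norm w
    rw [Complex.normSq_apply] at this
    nlinarith [norm_nonneg w]
  have hne : 1 + w ≠ 0 := by
    intro h
    have : w = -1 := by linear_combination h
    rw [this] at hw; simp at hw
  refine ⟨hne, ?_⟩
  have hn : 0 < Complex.normSq (1 + w) := Complex.normSq_pos.mpr hne
  rw [Complex.div_re, ← add_div]
  apply div_pos _ hn
  simp
  nlinarith

lemma aux_inv (z : ℂ) (hz : 0 < z.re) : 1 + z ≠ 0 ∧ ‖(1 - z) / (1 + z)‖ < 1 ∧
    (1 - (1 - z) / (1 + z)) / (1 + (1 - z) / (1 + z)) = z := by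
  have hne : 1 + z ≠ 0 := by
    intro h
    have := congrArg Complex.re h
    simp at this; linarith
  refine ⟨hne, ?_, ?_⟩
  · rw [norm_div, div_lt_one (norm_pos_iff.mpr hne), ← sq_lt_sq₀ (norm_nonneg _) (norm_nonneg _),
      Complex.sq_norm, Complex.sq_norm, Complex.normSq_apply, Complex.normSq_apply]
    simp
    nlinarith
  · have : 1 + (1 - z) / (1 + z) = 2 / (1 + z) := by field_simp; ring
    rw [this]; field_simp; ring

theorem stmt8 (h : ℂ → ℂ)
    (hhol : DifferentiableOn ℂ h {z : ℂ | 0 < z.re})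
    (hNev : ∃ B : ℝ, ∀ r : ℝ, 0 < r → r < 1 →
      (∫ θ in (-Real.pi)..Real.pi,
        max (Real.log ‖h ((1 - (r : ℂ) * Complex.exp (Complex.I * (θ : ℂ))) /
          (1 + (r : ℂ) * Complex.exp (Complex.I * (θ : ℂ))))‖) 0) ≤ B)
    (C₂ : ℝ) (hC₂ : 0 < C₂)
    (α : ℕ → ℝ)
    (hαpos : ∀ l : ℕ, 1 ≤ l → 0 < α l)
    (hαmono : StrictMonoOn α {l : ℕ | 1 ≤ l})
    (hαle : ∀ l : ℕ, 1 ≤ l → α l ≤ C₂ * l)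
    (L : Set ℕ) (hL : L ⊆ {l : ℕ | 1 ≤ l})
    (hLdiv : ¬ Summable fun l : L => (1 : ℝ) / ((l : ℕ) : ℝ))
    (hzero : ∀ l ∈ L, h ((α l : ℝ) : ℂ) = 0) :
    ∀ z : ℂ, 0 < z.re → h z = 0 := by
  classical
  obtain ⟨B, hB⟩ := hNev
  set f : ℂ → ℂ := fun w => h ((1 - w) / (1 + w)) with hfdef
  have hopen : IsOpen {z : ℂ | 0 < z.re} := isOpen_lt continuous_const Complex.continuous_re
  have hf : AnalyticOnNhd ℂ f (Metric.ball 0 1) := by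
    apply DifferentiableOn.analyticOnNhd _ Metric.isOpen_ball
    refine hhol.comp (t := {z : ℂ | 0 < z.re}) (f := fun w : ℂ => (1 - w) / (1 + w)) ?_ ?_
    · intro w hw
      have := (aux_re w (by simpa using hw)).1
      refine DifferentiableAt.differentiableWithinAt ?_
      fun_prop (disch := assumption)
    · intro w hw
      exact (aux_re w (by simpa using hw)).2
  by_contra hcon
  push Not at hcon
  obtain ⟨z₀, hz₀, hhz₀⟩ := hcon
  have hne : ∀ u ∈ Metric.ball (0 : ℂ) 1, meromorphicOrderAt f u ≠ ⊤ := by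
    intro u hu htop
    have hA := hf u hu
    rw [meromorphicOrderAt_eq_top_iff] at htop
    have hz := (hA.frequently_zero_iff_eventually_zero).mp htop.frequently
    have := hf.eqOn_zero_of_preconnected_of_eventuallyEq_zero
      (convex_ball (0:ℂ) 1).isPreconnected hu hz
    obtain ⟨_, h2, h3⟩ := aux_inv z₀ hz₀
    have h4 := this (x := (1 - z₀) / (1 + z₀)) (by simpa using h2)
    simp only [hfdef] at h4
    rw [h3] at h4
    exact hhz₀ h4
  have hBav : ∀ r : ℝ, 0 < r → r < 1 →
      Real.circleAverage (fun z => Real.log ‖f z‖) 0 r ≤ (2 * Real.pi)⁻¹ * B := by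
    intro r hr0 hr1
    have hsub : Metric.sphere (0 : ℂ) |r| ⊆ Metric.ball 0 1 := by
      rw [abs_of_pos hr0]
      exact Metric.sphere_subset_closedBall.trans (Metric.closedBall_subset_ball hr1)
    have hm := (hf.mono hsub).meromorphicOn
    have h1 : Real.circleAverage (fun z => Real.log ‖f z‖) 0 r ≤
        Real.circleAverage (fun z => Real.posLog ‖f z‖) 0 r := by
      refine Real.circleAverage_mono hm.circleIntegrable_log_norm
        hm.circleIntegrable_posLog_norm (fun x _ => ?_)
      exact le_max_right _ _
    refine h1.trans ?_
    rw [Real.circleAverage_eq_integral_add (-Real.pi), smul_eq_mul]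
    refine mul_le_mul_of_nonneg_left ?_ (by positivity)
    rw [intervalIntegral.integral_comp_add_right
      (fun θ => Real.posLog ‖f (circleMap 0 r θ)‖) (-Real.pi)]
    have h2 := hB r hr0 hr1
    refine le_of_eq_of_le ?_ h2
    rw [show 0 + -Real.pi = -Real.pi by ring, show 2 * Real.pi + -Real.pi = Real.pi by ring]
    congr 1
    ext θ
    simp only [Real.posLog, hfdef, circleMap, zero_add]
    rw [max_comm, mul_comm (θ : ℂ)]
  obtain ⟨K, hK⟩ := aux_disc_zeros f hf hne _ hBav
  apply hLdiv
  set c : ℝ := min (1 / C₂) (α 1) with hc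
  have hcpos : 0 < c := lt_min (by positivity) (hαpos 1 le_rfl)
  set w : ℕ → ℂ := fun l => (1 - (α l : ℂ)) / (1 + (α l : ℂ)) with hw
  have hwinv : ∀ l, 1 ≤ l → (1 - w l) / (1 + w l) = (α l : ℂ) := fun l hl =>
    (aux_inv (α l) (by simpa using hαpos l hl)).2.2
  have hest : ∀ l : ℕ, 1 ≤ l → c * (1 / (l : ℝ)) ≤ 1 - ‖w l‖ := by
    intro l hl
    have hl' : (1:ℝ) ≤ l := by exact_mod_cast hl
    have hlp : (0:ℝ) < l := by linarith
    have ha := hαpos l hl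
    have h1 : α 1 ≤ α l := hαmono.monotoneOn (by simp) hl hl
    have hnorm : ‖w l‖ = |1 - α l| / (1 + α l) := by
      have : w l = (((1 - α l) / (1 + α l) : ℝ) : ℂ) := by simp [hw]
      rw [this, Complex.norm_real, Real.norm_eq_abs, abs_div, abs_of_pos (by linarith : 0 < 1 + α l)]
    rw [hnorm]
    rcases le_total (α l) 1 with h2 | h2
    · rw [abs_of_nonneg (by linarith)]
      have e1 : 1 - (1 - α l) / (1 + α l) = 2 * α l / (1 + α l) := by field_simp; ring
      rw [e1, le_div_iff₀ (by linarith)]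
      have : c * (1 / (l:ℝ)) ≤ α l * 1 := by
        apply mul_le_mul ((min_le_right _ _).trans h1) _ (by positivity) ha.le
        rw [div_le_one hlp]; exact hl'
      nlinarith
    · rw [abs_of_nonpos (by linarith)]
      have e1 : 1 - -(1 - α l) / (1 + α l) = 2 / (1 + α l) := by field_simp; ring
      rw [e1]
      have h3 : c * (1 / (l:ℝ)) ≤ 1 / C₂ * (1 / (l:ℝ)) := by
        gcongr; exact min_le_left _ _
      have h4 : 1 / C₂ * (1 / (l:ℝ)) ≤ 1 / α l := by
        rw [div_mul_div_comm, one_mul]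
        exact one_div_le_one_div_of_le ha (hαle l hl)
      have h5 : 1 / α l ≤ 2 / (1 + α l) := by
        rw [div_le_div_iff₀ ha (by linarith)]; linarith
      linarith
  refine summable_of_sum_le (c := K / c + 1) (fun l => by positivity) (fun S => ?_)
  have hL1 : ∀ l : L, 1 ≤ (l : ℕ) := fun l => hL l.2
  have hwinj : Function.Injective (fun l : L => w l) := by
    intro a b hab
    have h1 := hwinv a (hL1 a)
    simp only at hab
    rw [hab, hwinv b (hL1 b)] at h1
    exact Subtype.ext (hαmono.injOn (hL1 a) (hL1 b) (by exact_mod_cast h1.symm))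
  rw [← Finset.sum_filter_add_sum_filter_not S (fun l : L => w l ≠ 0)]
  refine add_le_add ?_ ?_
  · rw [le_div_iff₀ hcpos, mul_comm, Finset.mul_sum]
    have h1 := hK ((S.filter (fun l : L => w l ≠ 0)).image (fun l : L => w l)) (by
      intro u hu
      simp only [Finset.mem_image, Finset.mem_filter] at hu
      obtain ⟨l, ⟨_, hl0⟩, rfl⟩ := hu
      refine ⟨?_, hl0, ?_⟩
      · rw [mem_ball_zero_iff]
        exact (aux_inv (α l) (by simpa using hαpos l (hL1 l))).2.1
      · simp only [hfdef]
        rw [hwinv l (hL1 l)]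
        exact hzero l l.2)
    rw [Finset.sum_image hwinj.injOn] at h1
    exact (Finset.sum_le_sum (fun (l : L) _ => hest (l : ℕ) (hL1 l))).trans h1
  · have hcard : (S.filter (fun l : L => ¬ w l ≠ 0)).card ≤ 1 := by
      rw [Finset.card_le_one]
      intro a ha b hb
      simp only [Finset.mem_filter, not_not] at ha hb
      exact hwinj (ha.2.trans hb.2.symm)
    refine (Finset.sum_le_card_nsmul _ _ 1 (fun l _ => ?_)).trans ?_
    · have : (1:ℝ) ≤ (l : ℕ) := by exact_mod_cast hL1 l
      exact (div_le_one (by linarith)).mpr this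
    · simpa using hcard
end

section
/- For every integer n ≥ 0 and every X ∈ (0,A), a_n(X) = [Γ(1−ν) / (2^{2n} · n! · Γ(n+1−ν))] · (A−X)^{2n+iμ}, where Γ denotes the complex Gamma function and complex powers of the positive real A−X are principal. -/
open MeasureTheory Set

theorem aux_int_s12 (A Y : ℝ) (h : Y < A) (s : ℂ) (hs : -1 < s.re) :
    ∫ T in Y..A, ((A - T : ℝ) : ℂ) ^ s = ((A - Y : ℝ) : ℂ) ^ (s + 1) / (s + 1) := by
  have h1 := intervalIntegral.integral_comp_sub_left (a := Y) (b := A)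
    (fun x : ℝ => (x : ℂ) ^ s) A
  rw [h1, sub_self, integral_cpow (Or.inl hs)]
  have : s + 1 ≠ 0 := by
    intro h0
    have := congrArg Complex.re h0
    simp at this
    linarith
  simp [Complex.zero_cpow this]

theorem aux_congr (A Y : ℝ) (h : Y < A) (f g : ℝ → ℂ) (hfg : ∀ T ∈ Ioo Y A, f T = g T) :
    ∫ T in Y..A, f T = ∫ T in Y..A, g T := by
  rw [intervalIntegral.integral_of_le h.le, intervalIntegral.integral_of_le h.le,
    integral_Ioc_eq_integral_Ioo, integral_Ioc_eq_integral_Ioo]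
  exact setIntegral_congr_fun measurableSet_Ioo hfg

theorem stmt12 (A μ : ℝ) (hA : 0 < A) (ν : ℂ) (hν : ν = 1 / 2 - Complex.I * (μ : ℂ))
    (aseq : ℕ → ℝ → ℂ)
    (h0 : ∀ X ∈ Ioo 0 A, aseq 0 X = ((A - X : ℝ) : ℂ) ^ (Complex.I * (μ : ℂ)))
    (hrec : ∀ (n : ℕ), ∀ X ∈ Ioo 0 A,
      aseq (n + 1) X = ((A - X : ℝ) : ℂ) ^ (Complex.I * (μ : ℂ)) *
        ∫ Y in X..A, ((A - Y : ℝ) : ℂ) ^ (-(2 * Complex.I * (μ : ℂ))) *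
          ∫ T in Y..A, ((A - T : ℝ) : ℂ) ^ (Complex.I * (μ : ℂ)) * aseq n T) :
    ∀ (n : ℕ), ∀ X ∈ Ioo 0 A,
      aseq n X =
        Complex.Gamma (1 - ν) /
            ((2 : ℂ) ^ (2 * n) * (n.factorial : ℂ) * Complex.Gamma ((n : ℂ) + 1 - ν)) *
          ((A - X : ℝ) : ℂ) ^ ((2 * n : ℂ) + Complex.I * (μ : ℂ)) := by
  have hre : ∀ n : ℕ, ((n : ℂ) + 1 - ν).re = n + 1 / 2 := by
    intro n
    rw [hν]
    simp
    ring
  have hne : ∀ n : ℕ, (n : ℂ) + 1 - ν ≠ 0 := by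
    intro n h
    have h2 := hre n
    rw [h, Complex.zero_re] at h2
    have : (0 : ℝ) ≤ n := n.cast_nonneg
    linarith
  have hG : ∀ n : ℕ, Complex.Gamma ((n : ℂ) + 1 - ν) ≠ 0 := by
    intro n
    apply Complex.Gamma_ne_zero_of_re_pos
    rw [hre]
    positivity
  intro n
  induction n with
  | zero =>
    intro X hX
    have := hG 0
    simp only [Nat.cast_zero, zero_add] at this
    rw [h0 X hX]
    simp [div_self this]
  | succ n ih =>
    intro X hX
    rw [hrec n X hX]
    set c : ℂ := Complex.Gamma (1 - ν) /
            ((2 : ℂ) ^ (2 * n) * (n.factorial : ℂ) * Complex.Gamma ((n : ℂ) + 1 - ν)) with hc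
    have inner : ∀ Y ∈ Ioo X A,
        ((A - Y : ℝ) : ℂ) ^ (-(2 * Complex.I * (μ : ℂ))) *
          ∫ T in Y..A, ((A - T : ℝ) : ℂ) ^ (Complex.I * (μ : ℂ)) * aseq n T
        = (c / (2 * ((n : ℂ) + 1 - ν))) * ((A - Y : ℝ) : ℂ) ^ ((2 * n + 1 : ℂ)) := by
      intro Y hY
      have e1 : ∫ T in Y..A, ((A - T : ℝ) : ℂ) ^ (Complex.I * (μ : ℂ)) * aseq n T
          = ∫ T in Y..A, c * ((A - T : ℝ) : ℂ) ^ ((2 * n : ℂ) + 2 * Complex.I * (μ : ℂ)) := by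
        apply aux_congr A Y hY.2
        intro T hT
        have hp : ((A - T : ℝ) : ℂ) ≠ 0 := by
          exact_mod_cast (sub_pos.2 hT.2).ne'
        rw [ih T ⟨by linarith [hX.1, hY.1, hT.1], hT.2⟩, mul_left_comm, ← Complex.cpow_add _ _ hp]
        congr 2
        ring
      have hp : ((A - Y : ℝ) : ℂ) ≠ 0 := by
        exact_mod_cast (sub_pos.2 hY.2).ne'
      rw [e1, intervalIntegral.integral_const_mul, aux_int_s12 A Y hY.2]
      · have e2 : (2 * n : ℂ) + 2 * Complex.I * (μ : ℂ) + 1 = 2 * ((n : ℂ) + 1 - ν) := by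
          rw [hν]; ring
        have e3 : (2 * n + 1 : ℂ) = -(2 * Complex.I * (μ : ℂ)) + 2 * ((n : ℂ) + 1 - ν) := by
          rw [hν]; ring
        rw [e2, e3, Complex.cpow_add _ _ hp]
        ring
      · have : (0 : ℝ) ≤ n := n.cast_nonneg
        simp
        linarith
    rw [aux_congr A X hX.2 _ _ inner, intervalIntegral.integral_const_mul, aux_int_s12 A X hX.2]
    · have hp : ((A - X : ℝ) : ℂ) ≠ 0 := by
        exact_mod_cast (sub_pos.2 hX.2).ne'
      have e4 : (2 * ((n + 1 : ℕ) : ℂ)) + Complex.I * (μ : ℂ)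
          = Complex.I * (μ : ℂ) + (2 * n + 1 + 1) := by
        push_cast; ring
      have e5 : ((n + 1 : ℕ) : ℂ) + 1 - ν = ((n : ℂ) + 1 - ν) + 1 := by
        push_cast; ring
      rw [e4, e5, Complex.Gamma_add_one _ (hne n), Complex.cpow_add (Complex.I * (μ : ℂ)) _ hp, hc,
        Nat.factorial_succ]
      have h1 := hne n
      have h2 := hG n
      have h3 : (n.factorial : ℂ) ≠ 0 := by exact_mod_cast n.factorial_ne_zero
      have h4 : (n : ℂ) + 1 ≠ 0 := by exact_mod_cast n.succ_ne_zero
      have e6 : (2 * n + 1 + 1 : ℂ) = 2 * (n + 1) := by ring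
      generalize ((A - X : ℝ) : ℂ) ^ (2 * n + 1 + 1 : ℂ) = P
      rw [e6]
      generalize Complex.Gamma ((n : ℂ) + 1 - ν) = G at *
      generalize (n : ℂ) + 1 - ν = w at *
      push_cast
      rw [show 2 * (n + 1) = 2 * n + 2 by ring, pow_add]
      field_simp
      try ring
    · have : (0 : ℝ) ≤ n := n.cast_nonneg
      simp
      linarith
end

section
/- Suppose e₀ : (X₀,A) → ℂ satisfies |e₀(X)| ≤ (C/2)(A−X)² for all X ∈ (X₀,A), and for n ≥ 1 define e_n(X) = u(X) ∫_X^A ∫_Y^A k(Y,T) [ e_{n−1}(T) − p(T) a_n(T) ] dT dY. Then for every integer n ≥ 0 and every X ∈ (X₀,A), |e_n(X)| ≤ C (n+1) (A−X)^{2n+2} / (2n+2)!. -/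
open MeasureTheory Set

theorem aux_bound (A Y c : ℝ) (m : ℕ) (hY : Y ≤ A) (f : ℝ → ℂ)
    (hf : ∀ T ∈ Ioo Y A, ‖f T‖ ≤ c * (A - T) ^ m / (m.factorial : ℝ)) :
    ‖∫ T in Y..A, f T‖ ≤ c * (A - Y) ^ (m + 1) / ((m + 1).factorial : ℝ) := by
  have hint : ∫ T in Y..A, c * (A - T) ^ m / (m.factorial : ℝ)
      = c * (A - Y) ^ (m + 1) / ((m + 1).factorial : ℝ) := by
    have h1 : ∫ T in Y..A, (A - T) ^ m = (A - Y) ^ (m + 1) / ((m : ℝ) + 1) := by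
      rw [intervalIntegral.integral_comp_sub_left (fun x => x ^ m) A]
      simp [integral_pow]
    rw [intervalIntegral.integral_div, intervalIntegral.integral_const_mul, h1,
      Nat.factorial_succ]
    have : (m.factorial : ℝ) ≠ 0 := by positivity
    have : (m : ℝ) + 1 ≠ 0 := by positivity
    push_cast
    field_simp
  rw [← hint]
  apply intervalIntegral.norm_integral_le_of_norm_le hY
  · have : ∀ᵐ t : ℝ, t ≠ A := by
      simp [ae_iff]
    filter_upwards [this] with t ht hmem
    exact hf t ⟨hmem.1, lt_of_le_of_ne hmem.2 ht⟩
  · exact (by fun_prop : Continuous fun T : ℝ => c * (A - T) ^ m / (m.factorial : ℝ)).intervalIntegrable _ _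

theorem stmt14 (A X₀ C : ℝ) (hA : 0 < A) (hX₀ : X₀ ∈ Ioo 0 A) (hC : 0 < C)
    (u : ℝ → ℂ) (hu_cont : ContinuousOn u (Ioo 0 A)) (hu_bd : ∀ X ∈ Ioo 0 A, ‖u X‖ ≤ 1)
    (k : ℝ → ℝ → ℂ)
    (hk_cont : ContinuousOn (fun p : ℝ × ℝ => k p.1 p.2)
      {p : ℝ × ℝ | 0 < p.1 ∧ p.1 ≤ p.2 ∧ p.2 < A})
    (hk_bd : ∀ Y T : ℝ, 0 < Y → Y ≤ T → T < A → ‖k Y T‖ ≤ 1)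
    (p : ℝ → ℂ) (hp_cont : ContinuousOn p (Ioo X₀ A)) (hp_bd : ∀ T ∈ Ioo X₀ A, ‖p T‖ ≤ C)
    (aseq : ℕ → ℝ → ℂ)
    (ha_bd : ∀ (n : ℕ), ∀ X ∈ Ioo 0 A,
      ‖aseq n X‖ ≤ (A - X) ^ (2 * n) / ((2 * n).factorial : ℝ))
    (e : ℕ → ℝ → ℂ)
    (he0 : ∀ X ∈ Ioo X₀ A, ‖e 0 X‖ ≤ C / 2 * (A - X) ^ 2)
    (herec : ∀ (n : ℕ), ∀ X ∈ Ioo X₀ A,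
      e (n + 1) X = u X * ∫ Y in X..A, ∫ T in Y..A, k Y T * (e n T - p T * aseq (n + 1) T)) :
    ∀ (n : ℕ), ∀ X ∈ Ioo X₀ A,
      ‖e n X‖ ≤ C * ((n : ℝ) + 1) * (A - X) ^ (2 * n + 2) / ((2 * n + 2).factorial : ℝ) := by
  intro n
  induction n with
  | zero =>
    intro X hX
    have := he0 X hX
    simp only [Nat.factorial] at *
    norm_num at *
    linarith
  | succ n ih =>
    intro X hX
    have hX0 := hX₀.1
    rw [herec n X hX, norm_mul]
    have hu := hu_bd X ⟨hX0.trans hX.1, hX.2⟩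
    refine (mul_le_of_le_one_left (norm_nonneg _) hu).trans ?_
    have key := aux_bound A X (C * ((n : ℝ) + 2)) (2 * n + 3) hX.2.le
      (fun Y => ∫ T in Y..A, k Y T * (e n T - p T * aseq (n + 1) T)) ?_
    · refine key.trans (le_of_eq ?_)
      rw [show 2 * (n + 1) + 2 = 2 * n + 3 + 1 by ring]
      push_cast
      ring
    · intro Y hY
      apply aux_bound A Y (C * ((n : ℝ) + 2)) (2 * n + 2) hY.2.le
      intro T hT
      have hT' : T ∈ Ioo X₀ A := ⟨hX.1.trans (hY.1.trans hT.1), hT.2⟩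
      rw [norm_mul]
      have hk := hk_bd Y T (hX0.trans (hX.1.trans hY.1)) hT.1.le hT.2
      refine (mul_le_of_le_one_left (norm_nonneg _) hk).trans ?_
      refine (norm_sub_le _ _).trans ?_
      rw [norm_mul]
      have h1 := ih T hT'
      have h2 := mul_le_mul (hp_bd T hT') (ha_bd (n + 1) T ⟨hX0.trans hT'.1, hT.2⟩)
        (norm_nonneg _) hC.le
      rw [show 2 * (n + 1) = 2 * n + 2 by ring] at h2
      refine (add_le_add h1 h2).trans (le_of_eq ?_)
      ring
end
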